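/- Let Q be a quadratic form in three variables with integer coefficients of signature (2,1), and let v₀ ∈ ℤ³ with Q(v₀) > 0 be such that the stabilizer subgroup of v₀ in SO_Q is isotropic over ℚ; concretely, assume that the group {g ∈ SL(3,ℤ) : Q(xg) = Q(x) for all x ∈ ℝ³ and v₀g = v₀} is finite. Then for any norm ‖·‖ on ℝ³ there exists a constant c > 0 such that #{x ∈ ℤ³ : Q(x) = Q(v₀), ‖x‖ < T}/(T·log T) → c as T → ∞. -/

import Mathlib

noncomputable section
open Matrix Filter Topology

/-- the integral quadratic form with coefficient matrix `c`, over `ℤ`. -/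
def QZ (c : Fin 3 → Fin 3 → ℤ) (x : Fin 3 → ℤ) : ℤ :=
  ∑ i : Fin 3, ∑ j : Fin 3, c i j * x i * x j

/-- the integral quadratic form with coefficient matrix `c`, over `ℝ`. -/
def QR (c : Fin 3 → Fin 3 → ℤ) (v : Fin 3 → ℝ) : ℝ :=
  ∑ i : Fin 3, ∑ j : Fin 3, (c i j : ℝ) * v i * v j

/-- A positively homogeneous, Lipschitz function on the plane bounded below by a norm. -/
structure PlaneGauge (ρ : ℝ → ℝ → ℝ) : Prop where
  homog : ∀ t x y, 0 ≤ t → ρ (t * x) (t * y) = t * ρ x y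
  lip : ∃ C, ∀ x y h k, ρ (x + h) (y + k) ≤ ρ x y + C * (|h| + |k|)
  lower : ∃ κ > 0, ∀ x y, κ * (|x| + |y|) ≤ ρ x y

namespace PlaneGauge

variable {ρ : ℝ → ℝ → ℝ}

lemma nonneg (hρ : PlaneGauge ρ) (x y : ℝ) : 0 ≤ ρ x y := by
  obtain ⟨κ, hκ, h⟩ := hρ.lower
  exact le_trans (by positivity) (h x y)

lemma lip_pos (hρ : PlaneGauge ρ) :
    ∃ C > 0, ∀ x y h k, ρ (x + h) (y + k) ≤ ρ x y + C * (|h| + |k|) := by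
  obtain ⟨C, hC⟩ := hρ.lip
  refine ⟨max C 1, by positivity, fun x y h k => (hC x y h k).trans ?_⟩
  gcongr
  exact le_max_left _ _

lemma continuous (hρ : PlaneGauge ρ) : Continuous (fun v : Fin 2 → ℝ => ρ (v 0) (v 1)) := by
  obtain ⟨C, hC, h⟩ := hρ.lip_pos
  refine (LipschitzWith.of_dist_le_mul (K := ⟨2 * C, by positivity⟩) fun v w => ?_).continuous
  have e (v w : Fin 2 → ℝ) : ρ (v 0) (v 1) - ρ (w 0) (w 1) ≤ 2 * C * dist v w := by
    have h1 := h (w 0) (w 1) (v 0 - w 0) (v 1 - w 1)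
    have h2 := dist_le_pi_dist v w 0
    have h3 := dist_le_pi_dist v w 1
    rw [Real.dist_eq] at h2 h3
    simp only [add_sub_cancel] at h1
    nlinarith
  rw [Real.dist_eq, abs_sub_le_iff]
  exact ⟨e v w, dist_comm v w ▸ e w v⟩

lemma finite_le (hρ : PlaneGauge ρ) (r : ℝ) : {l : ℤ × ℤ | ρ l.1 l.2 ≤ r}.Finite := by
  obtain ⟨κ, hκ, h⟩ := hρ.lower
  refine (Set.finite_Icc ((-⌈r / κ⌉, -⌈r / κ⌉) : ℤ × ℤ) (⌈r / κ⌉, ⌈r / κ⌉)).subset ?_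
  rintro ⟨p, q⟩ hl
  have h1 : |(p : ℝ)| + |(q : ℝ)| ≤ r / κ := by
    rw [le_div_iff₀ hκ, mul_comm]; exact (h p q).trans hl
  have h2 : |(p : ℝ)| ≤ ⌈r / κ⌉ := by
    linarith [abs_nonneg (q : ℝ), Int.le_ceil (r / κ)]
  have h3 : |(q : ℝ)| ≤ ⌈r / κ⌉ := by
    linarith [abs_nonneg (p : ℝ), Int.le_ceil (r / κ)]
  have h2' : |p| ≤ ⌈r / κ⌉ := by exact_mod_cast h2
  have h3' : |q| ≤ ⌈r / κ⌉ := by exact_mod_cast h3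
  rw [abs_le] at h2' h3'
  exact ⟨⟨h2'.1, h3'.1⟩, ⟨h2'.2, h3'.2⟩⟩

lemma one_le_abs_add_abs {l : ℤ × ℤ} (hl : l ≠ 0) : (1 : ℝ) ≤ |(l.1 : ℝ)| + |(l.2 : ℝ)| := by
  have : 1 ≤ |l.1| + |l.2| := by
    by_contra! hlt
    have h1 := abs_nonneg l.1
    have h2 := abs_nonneg l.2
    exact hl (Prod.ext (abs_eq_zero.mp (by omega)) (abs_eq_zero.mp (by omega)))
  exact_mod_cast this

/-- The number of nonzero lattice points of gauge at most `r` is `O(r ^ 2)`, uniformly in `r`. -/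
lemma ncard_ne_zero_le (hρ : PlaneGauge ρ) :
    ∃ C > 0, ∀ r : ℝ, ({l : ℤ × ℤ | l ≠ 0 ∧ ρ l.1 l.2 ≤ r}.ncard : ℝ) ≤ C * r ^ 2 := by
  obtain ⟨κ, hκ, h⟩ := hρ.lower
  refine ⟨(3 / κ) ^ 2, by positivity, fun r => ?_⟩
  rcases Set.eq_empty_or_nonempty {l : ℤ × ℤ | l ≠ 0 ∧ ρ l.1 l.2 ≤ r} with he | ⟨l, hl, hlr⟩
  · rw [he, Set.ncard_empty]; push_cast; positivity
  have hr : 1 ≤ r / κ := by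
    rw [le_div_iff₀ hκ, one_mul]
    nlinarith [h l.1 l.2, one_le_abs_add_abs hl]
  set n : ℤ := ⌊r / κ⌋ with hn
  have hn0 : 0 ≤ n := Int.floor_nonneg.mpr (by linarith)
  have hsub : {l : ℤ × ℤ | l ≠ 0 ∧ ρ l.1 l.2 ≤ r} ⊆
      ((Finset.Icc (-n) n ×ˢ Finset.Icc (-n) n : Finset (ℤ × ℤ)) : Set (ℤ × ℤ)) := by
    rintro ⟨p, q⟩ ⟨-, hl⟩
    have h1 : |(p : ℝ)| + |(q : ℝ)| ≤ r / κ := by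
      rw [le_div_iff₀ hκ, mul_comm]; exact (h p q).trans hl
    have h2 : |p| ≤ n := by
      rw [hn, Int.le_floor]; push_cast; linarith [abs_nonneg (q : ℝ)]
    have h3 : |q| ≤ n := by
      rw [hn, Int.le_floor]; push_cast; linarith [abs_nonneg (p : ℝ)]
    rw [abs_le] at h2 h3
    simp only [Finset.coe_product, Finset.coe_Icc, Set.mem_prod, Set.mem_Icc]
    exact ⟨h2, h3⟩
  have hcard := Set.ncard_le_ncard hsub (Finset.finite_toSet _)
  rw [Set.ncard_coe_finset, Finset.card_product, Int.card_Icc] at hcard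
  have h4 : ((n + 1 - -n).toNat : ℝ) ≤ 3 / κ * r := by
    have h5 : (((n + 1 - -n).toNat : ℤ) : ℝ) = 2 * n + 1 := by
      rw [Int.toNat_of_nonneg (by omega)]; push_cast; ring
    have h6 : (n : ℝ) ≤ r / κ := Int.floor_le _
    rw [show ((n + 1 - -n).toNat : ℝ) = (((n + 1 - -n).toNat : ℤ) : ℝ) by push_cast; rfl, h5]
    rw [div_mul_eq_mul_div, mul_div_assoc]
    linarith
  calc (({l : ℤ × ℤ | l ≠ 0 ∧ ρ l.1 l.2 ≤ r}.ncard : ℕ) : ℝ)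
      ≤ ((n + 1 - -n).toNat : ℝ) * ((n + 1 - -n).toNat : ℝ) := by exact_mod_cast hcard
    _ ≤ (3 / κ * r) * (3 / κ * r) :=
        mul_le_mul h4 h4 (Nat.cast_nonneg _) ((Nat.cast_nonneg _).trans h4)
    _ = _ := by ring

open MeasureTheory Pointwise in
lemma volume_level_set (hρ : PlaneGauge ρ) :
    volume {v : Fin 2 → ℝ | ρ (v 0) (v 1) = 1} = 0 := by
  have hcount := Measure.countable_meas_level_set_pos (μ := (volume : Measure (Fin 2 → ℝ)))
    hρ.continuous.measurable
  obtain ⟨t, ht, htp⟩ : ∃ t ∈ Set.Icc (1 : ℝ) 2,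
      t ∉ {t : ℝ | 0 < volume {v : Fin 2 → ℝ | ρ (v 0) (v 1) = t}} := by
    by_contra! hc
    have : (Set.Icc (1 : ℝ) 2).Countable := hcount.mono hc
    rw [← Cardinal.le_aleph0_iff_set_countable, Cardinal.mk_Icc_real (by norm_num)] at this
    exact absurd this (not_le.mpr Cardinal.aleph0_lt_continuum)
  have ht0 : 0 < t := by linarith [ht.1]
  have hz : volume {v : Fin 2 → ℝ | ρ (v 0) (v 1) = t} = 0 := by simpa using htp
  have hs : {v : Fin 2 → ℝ | ρ (v 0) (v 1) = t} = t • {v : Fin 2 → ℝ | ρ (v 0) (v 1) = 1} := by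
    ext v
    rw [Set.mem_smul_set_iff_inv_smul_mem₀ ht0.ne']
    simp only [Set.mem_ofPred_eq, Pi.smul_apply, smul_eq_mul]
    rw [hρ.homog _ _ _ (by positivity), inv_mul_eq_one₀ ht0.ne']
    exact eq_comm
  rw [hs, Measure.addHaar_smul] at hz
  simpa [ht0.ne'] using hz

open MeasureTheory Pointwise in
/-- Lattice points of the plane of gauge at most `r`. -/
lemma tendsto_ncard (hρ : PlaneGauge ρ) :
    ∃ V > 0, Tendsto (fun r : ℝ => ({l : ℤ × ℤ | ρ l.1 l.2 ≤ r}.ncard : ℝ) / r ^ 2)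
      atTop (𝓝 V) := by
  set s : Set (Fin 2 → ℝ) := {v | ρ (v 0) (v 1) ≤ 1} with hs
  have hz : ρ 0 0 = 0 := by simpa using hρ.homog 0 0 0 le_rfl
  have hbdd : Bornology.IsBounded s := by
    obtain ⟨κ, hκ, h⟩ := hρ.lower
    refine (Metric.isBounded_closedBall (x := (0 : Fin 2 → ℝ)) (r := 1 / κ)).subset fun v hv => ?_
    have h1 : |v 0| + |v 1| ≤ 1 / κ := by
      rw [le_div_iff₀ hκ, mul_comm]; exact (h _ _).trans hv
    rw [mem_closedBall_zero_iff, pi_norm_le_iff_of_nonneg (by positivity), Fin.forall_fin_two,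
      Real.norm_eq_abs, Real.norm_eq_abs]
    exact ⟨by linarith [abs_nonneg (v 1)], by linarith [abs_nonneg (v 0)]⟩
  have hclosed : IsClosed s := isClosed_le hρ.continuous continuous_const
  have hfr : volume (frontier s) = 0 :=
    measure_mono_null (frontier_le_subset_eq hρ.continuous continuous_const) hρ.volume_level_set
  have hpos : 0 < volume.real s := by
    rw [measureReal_def, ENNReal.toReal_pos_iff]
    refine ⟨?_, hbdd.measure_lt_top⟩
    have ho : IsOpen {v : Fin 2 → ℝ | ρ (v 0) (v 1) < 1} :=
      isOpen_lt hρ.continuous continuous_const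
    exact (ho.measure_pos volume ⟨0, by simp [hz]⟩).trans_le
      (measure_mono fun v (hv : ρ (v 0) (v 1) < 1) => hv.le)
  refine ⟨volume.real s, hpos, ?_⟩
  have hmono : ∀ ⦃x y : ℝ⦄, 0 < x → x ≤ y → x • s ⊆ y • s := by
    intro x y hx hxy v hv
    have hy : 0 < y := hx.trans_le hxy
    rw [Set.mem_smul_set_iff_inv_smul_mem₀ hx.ne'] at hv
    rw [Set.mem_smul_set_iff_inv_smul_mem₀ hy.ne']
    simp only [hs, Set.mem_ofPred_eq, Pi.smul_apply, smul_eq_mul] at hv ⊢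
    rw [hρ.homog _ _ _ (by positivity)] at hv ⊢
    exact (mul_le_mul_of_nonneg_right (inv_anti₀ hx hxy) (hρ.nonneg _ _)).trans hv
  have key := tendsto_card_div_pow_atTop_volume' s hbdd hclosed.measurableSet hfr hmono
  refine key.congr' ?_
  filter_upwards [eventually_gt_atTop 0] with r hr
  rw [Fintype.card_fin, ← Nat.card_coe_set_eq]
  congr 2
  symm
  refine Nat.card_congr (Equiv.ofBijective
    (fun l => ⟨r⁻¹ • ![(l.1.1 : ℝ), (l.1.2 : ℝ)], ?_, ?_⟩) ⟨?_, ?_⟩)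
  · have := l.2
    simp only [Set.mem_ofPred_eq] at this
    simp only [hs, Set.mem_ofPred_eq, Pi.smul_apply, smul_eq_mul, Matrix.cons_val_zero,
      Matrix.cons_val_one]
    rw [hρ.homog _ _ _ (by positivity), inv_mul_le_iff₀ hr, mul_one]
    exact this
  · refine Set.smul_mem_smul_set ?_
    rw [SetLike.mem_coe, Module.Basis.mem_span_iff_repr_mem]
    intro i
    fin_cases i <;> simp
  · intro a b hab
    have h := smul_right_injective _ (inv_ne_zero hr.ne') (Subtype.ext_iff.mp hab)
    have h0 := congrFun h 0
    have h1 := congrFun h 1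
    simp only [Matrix.cons_val_zero, Matrix.cons_val_one, Int.cast_inj] at h0 h1
    exact Subtype.ext (Prod.ext h0 h1)
  · rintro ⟨v, hv, hvL⟩
    obtain ⟨u, hu, rfl⟩ := hvL
    rw [SetLike.mem_coe, Module.Basis.mem_span_iff_repr_mem] at hu
    obtain ⟨p, hp⟩ := hu 0
    obtain ⟨q, hq⟩ := hu 1
    simp only [Pi.basisFun_repr, algebraMap_int_eq, eq_intCast] at hp hq
    have hu_eq : u = ![(p : ℝ), (q : ℝ)] := by
      ext i; fin_cases i <;> simp [hp, hq]
    refine ⟨⟨(p, q), ?_⟩, ?_⟩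
    · simp only [hs, Set.mem_ofPred_eq, Pi.smul_apply, smul_eq_mul] at hv
      rw [hρ.homog _ _ _ (by positivity), inv_mul_le_iff₀ hr, mul_one, ← hp, ← hq] at hv
      exact hv
    · simp [hu_eq]

/-- Lattice points of the plane in a fixed residue class, of gauge at most `r`. -/
lemma tendsto_ncard_modEq (hρ : PlaneGauge ρ) :
    ∃ V > 0, ∀ K : ℕ, 0 < K → ∀ a b : ℤ, Tendsto (fun r : ℝ =>
      ({l : ℤ × ℤ | l.1 ≡ a [ZMOD K] ∧ l.2 ≡ b [ZMOD K] ∧ ρ l.1 l.2 ≤ r}.ncard : ℝ) / r ^ 2)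
      atTop (𝓝 (V / K ^ 2)) := by
  obtain ⟨V, hV, hlim⟩ := hρ.tendsto_ncard
  obtain ⟨C, hC, hlip⟩ := hρ.lip_pos
  refine ⟨V, hV, fun K hK a b => ?_⟩
  have hK' : (0 : ℝ) < K := by exact_mod_cast hK
  set c : ℝ := C * (|(a : ℝ)| + |(b : ℝ)|) with hc
  have hscale (e : ℝ) : Tendsto (fun r : ℝ =>
      ({l : ℤ × ℤ | ρ l.1 l.2 ≤ (r + e) / K}.ncard : ℝ) / r ^ 2) atTop (𝓝 (V / K ^ 2)) := by
    have h1 : Tendsto (fun r : ℝ => (r + e) / K) atTop atTop :=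
      (tendsto_atTop_add_const_right _ e tendsto_id).atTop_div_const hK'
    have h2 : Tendsto (fun r : ℝ => (1 + e / r) / K) atTop (𝓝 ((1 + 0) / K)) :=
      (tendsto_const_nhds.add (tendsto_const_nhds.div_atTop tendsto_id)).div_const _
    have h3 := (hlim.comp h1).mul (h2.pow 2)
    rw [show V * ((1 + 0) / (K : ℝ)) ^ 2 = V / K ^ 2 by field_simp; ring] at h3
    refine h3.congr' ?_
    filter_upwards [eventually_gt_atTop 0, h1.eventually_gt_atTop 0] with r hr hr'
    have : r + e ≠ 0 := by
      intro h0; rw [h0] at hr'; simp at hr'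
    have h4 : (1 + e / r) / (K : ℝ) = (r + e) / K / r := by field_simp
    have h5 : (r + e) / K ≠ 0 := hr'.ne'
    simp only [Function.comp]
    rw [h4]
    generalize (r + e) / (K : ℝ) = x at h5
    field_simp
  have hset (r : ℝ) :
      {l : ℤ × ℤ | l.1 ≡ a [ZMOD K] ∧ l.2 ≡ b [ZMOD K] ∧ ρ l.1 l.2 ≤ r}.ncard =
      {j : ℤ × ℤ | ρ (K * j.1 + a) (K * j.2 + b) ≤ r}.ncard := by
    symm
    refine Set.ncard_congr (fun j _ => (K * j.1 + a, K * j.2 + b)) ?_ ?_ ?_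
    · intro j hj
      refine ⟨?_, ?_, ?_⟩
      · simp [Int.ModEq]
      · simp [Int.ModEq]
      · simpa using hj
    · intro i j _ _ h
      have hK0 : (K : ℤ) ≠ 0 := by exact_mod_cast hK.ne'
      simp only [Prod.mk.injEq, add_left_inj, mul_right_inj' hK0] at h
      exact Prod.ext h.1 h.2
    · rintro ⟨p, q⟩ ⟨h1, h2, h3⟩
      obtain ⟨u, hu⟩ := h1.symm.dvd
      obtain ⟨v, hv⟩ := h2.symm.dvd
      dsimp only at hu hv h3
      obtain rfl : p = K * u + a := by linarith
      obtain rfl : q = K * v + b := by linarith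
      exact ⟨(u, v), by simpa using h3, rfl⟩
  have hK2 (x y : ℝ) : ρ (K * x) (K * y) = K * ρ x y := hρ.homog _ _ _ hK'.le
  have hfin (r : ℝ) : {j : ℤ × ℤ | ρ (K * j.1 + a) (K * j.2 + b) ≤ r} ⊆
      {l : ℤ × ℤ | ρ l.1 l.2 ≤ (r + c) / K} := by
    intro j (hj : _ ≤ r)
    have := hlip (K * j.1 + a) (K * j.2 + b) (-a) (-b)
    rw [add_neg_cancel_right, add_neg_cancel_right, abs_neg, abs_neg, hK2] at this
    rw [Set.mem_ofPred_eq, le_div_iff₀ hK']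
    linarith [show ρ (K * j.1 + a) (K * j.2 + b) ≤ r from hj]
  refine tendsto_of_tendsto_of_tendsto_of_le_of_le (hscale (-c)) (hscale c) ?_ ?_
  · intro r
    dsimp only
    rw [hset]
    refine div_le_div_of_nonneg_right (Nat.cast_le.mpr (Set.ncard_le_ncard ?_
      ((hρ.finite_le _).subset (hfin r)))) (sq_nonneg r)
    intro j hj
    have := hlip (K * j.1) (K * j.2) a b
    rw [Set.mem_ofPred_eq, le_div_iff₀ hK'] at hj
    rw [hK2] at this
    rw [Set.mem_ofPred_eq]
    linarith
  · intro r
    dsimp only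
    rw [hset]
    exact div_le_div_of_nonneg_right (Nat.cast_le.mpr (Set.ncard_le_ncard (hfin r)
      (hρ.finite_le _))) (sq_nonneg r)

open ArithmeticFunction in
lemma ncard_isCoprime (s : Set (ℤ × ℤ)) (hs : s.Finite) :
    ∃ D : ℕ, (∀ d : ℕ, D ≤ d → {l : ℤ × ℤ | l ≠ 0 ∧ (d : ℤ) ∣ l.1 ∧ (d : ℤ) ∣ l.2 ∧ l ∈ s} = ∅) ∧
      ({l : ℤ × ℤ | IsCoprime l.1 l.2 ∧ l ∈ s}.ncard : ℤ) =
      ∑ d ∈ Finset.range D, moebius d *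
        ({l : ℤ × ℤ | l ≠ 0 ∧ (d : ℤ) ∣ l.1 ∧ (d : ℤ) ∣ l.2 ∧ l ∈ s}.ncard : ℤ) := by
  classical
  set W : Finset (ℤ × ℤ) := hs.toFinset.filter (· ≠ 0) with hW
  have hgcd {l : ℤ × ℤ} (hl : l ≠ 0) : Int.gcd l.1 l.2 ≠ 0 := by
    rw [Ne, Int.gcd_eq_zero_iff]
    rintro ⟨h1, h2⟩
    exact hl (Prod.ext h1 h2)
  set D : ℕ := W.sup (fun l => Int.gcd l.1 l.2) + 1 with hD
  have hlt {l : ℤ × ℤ} (hl : l ∈ W) : Int.gcd l.1 l.2 < D :=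
    Nat.lt_succ_of_le (Finset.le_sup (f := fun l : ℤ × ℤ => Int.gcd l.1 l.2) hl)
  have hmemW {l : ℤ × ℤ} : l ∈ W ↔ l ∈ s ∧ l ≠ 0 := by simp [hW]
  refine ⟨D, ?_, ?_⟩
  · intro d hd
    rw [Set.eq_empty_iff_forall_notMem]
    rintro l ⟨hl0, h1, h2, hls⟩
    have h3 := Nat.le_of_dvd (Nat.pos_of_ne_zero (hgcd hl0)) 
      (Int.natCast_dvd_natCast.mp (Int.dvd_coe_gcd h1 h2))
    exact absurd (hlt (hmemW.mpr ⟨hls, hl0⟩)) (by omega)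
  · have hE (d : ℕ) : ({l : ℤ × ℤ | l ≠ 0 ∧ (d : ℤ) ∣ l.1 ∧ (d : ℤ) ∣ l.2 ∧ l ∈ s}.ncard : ℤ) =
        ∑ l ∈ W, if d ∣ Int.gcd l.1 l.2 then 1 else 0 := by
      rw [Finset.sum_boole, show {l : ℤ × ℤ | l ≠ 0 ∧ (d : ℤ) ∣ l.1 ∧ (d : ℤ) ∣ l.2 ∧ l ∈ s} =
        ((W.filter fun l => d ∣ Int.gcd l.1 l.2 : Finset (ℤ × ℤ)) : Set (ℤ × ℤ)) from ?_,
        Set.ncard_coe_finset]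
      ext l
      simp only [Set.mem_ofPred_eq, Finset.coe_filter, hmemW, ← Int.natCast_dvd_natCast (n := Int.gcd _ _),
        Int.dvd_coe_gcd_iff]
      tauto
    have hP : ({l : ℤ × ℤ | IsCoprime l.1 l.2 ∧ l ∈ s}.ncard : ℤ) =
        ∑ l ∈ W, if Int.gcd l.1 l.2 = 1 then 1 else 0 := by
      rw [Finset.sum_boole, show {l : ℤ × ℤ | IsCoprime l.1 l.2 ∧ l ∈ s} =
        ((W.filter fun l => Int.gcd l.1 l.2 = 1 : Finset (ℤ × ℤ)) : Set (ℤ × ℤ)) from ?_,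
        Set.ncard_coe_finset]
      ext l
      simp only [Set.mem_ofPred_eq, Finset.coe_filter, hmemW, Int.isCoprime_iff_gcd_eq_one]
      constructor
      · rintro ⟨h1, h2⟩
        refine ⟨⟨h2, ?_⟩, h1⟩
        rintro rfl
        simp at h1
      · tauto
    simp_rw [hE, hP, Finset.mul_sum]
    rw [Finset.sum_comm]
    refine Finset.sum_congr rfl fun l hl => ?_
    have hg := hgcd (hmemW.mp hl).2
    have h1 := congrArg (fun f : ArithmeticFunction ℤ => f (Int.gcd l.1 l.2)) moebius_mul_coe_zeta
    simp only [coe_mul_zeta_apply, ArithmeticFunction.one_apply] at h1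
    rw [← h1]
    simp only [mul_ite, mul_one, mul_zero]
    rw [← Finset.sum_filter]
    refine Finset.sum_congr ?_ fun _ _ => rfl
    ext d
    simp only [Nat.mem_divisors, Finset.mem_filter, Finset.mem_range]
    exact ⟨fun h => ⟨(Nat.le_of_dvd (Nat.pos_of_ne_zero hg) h.1).trans_lt (hlt hl), h.1⟩,
      fun h => ⟨h.2, hg⟩⟩

/-- A uniform bound for the number of nonzero lattice points divisible by `d`. -/
lemma ncard_dvd_le (hρ : PlaneGauge ρ) : ∃ C > 0, ∀ (d : ℕ) (r : ℝ),
    ({l : ℤ × ℤ | l ≠ 0 ∧ (d : ℤ) ∣ l.1 ∧ (d : ℤ) ∣ l.2 ∧ ρ l.1 l.2 ≤ r}.ncard : ℝ) ≤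
      C * (r ^ 2 / d ^ 2) := by
  obtain ⟨C, hC, h⟩ := hρ.ncard_ne_zero_le
  refine ⟨C, hC, fun d r => ?_⟩
  rcases Nat.eq_zero_or_pos d with rfl | hd
  · rw [show {l : ℤ × ℤ | l ≠ 0 ∧ ((0 : ℕ) : ℤ) ∣ l.1 ∧ ((0 : ℕ) : ℤ) ∣ l.2 ∧ ρ l.1 l.2 ≤ r} =
      ∅ from ?_]
    · simp
    · rw [Set.eq_empty_iff_forall_notMem]
      rintro l ⟨h0, h1, h2, -⟩
      simp only [Nat.cast_zero, zero_dvd_iff] at h1 h2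
      exact h0 (Prod.ext h1 h2)
  have hd' : (0 : ℝ) < d := by exact_mod_cast hd
  have hsub : {l : ℤ × ℤ | l ≠ 0 ∧ (d : ℤ) ∣ l.1 ∧ (d : ℤ) ∣ l.2 ∧ ρ l.1 l.2 ≤ r} ⊆
      (fun l : ℤ × ℤ => ((d : ℤ) * l.1, (d : ℤ) * l.2)) ''
        {l : ℤ × ℤ | l ≠ 0 ∧ ρ l.1 l.2 ≤ r / d} := by
    rintro ⟨p, q⟩ ⟨h0, ⟨u, rfl⟩, ⟨v, rfl⟩, h3⟩
    refine ⟨(u, v), ⟨?_, ?_⟩, rfl⟩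
    · intro h4
      simp only [Prod.mk_eq_zero] at h4
      exact h0 (by simp [h4.1, h4.2])
    · push_cast at h3
      rw [hρ.homog _ _ _ hd'.le] at h3
      rwa [le_div_iff₀ hd', mul_comm]
  have hfin : {l : ℤ × ℤ | l ≠ 0 ∧ ρ l.1 l.2 ≤ r / d}.Finite :=
    (hρ.finite_le (r / d)).subset fun l hl => hl.2
  calc _ ≤ ({l : ℤ × ℤ | l ≠ 0 ∧ ρ l.1 l.2 ≤ r / d}.ncard : ℝ) := by
        exact_mod_cast (Set.ncard_le_ncard hsub (hfin.image _)).trans (Set.ncard_image_le hfin)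
    _ ≤ _ := by rw [← div_pow]; exact h _

/-- Primitive lattice points in a residue class that contains a primitive point. -/
lemma tendsto_ncard_isCoprime_modEq (hρ : PlaneGauge ρ) (M : ℕ) (hM : 0 < M) (a b : ℤ)
    (hab : ∃ l : ℤ × ℤ, IsCoprime l.1 l.2 ∧ l.1 ≡ a [ZMOD M] ∧ l.2 ≡ b [ZMOD M]) :
    ∃ c > 0, Tendsto (fun r : ℝ =>
      ({l : ℤ × ℤ | IsCoprime l.1 l.2 ∧ l.1 ≡ a [ZMOD M] ∧ l.2 ≡ b [ZMOD M] ∧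
        ρ l.1 l.2 ≤ r}.ncard : ℝ) / r ^ 2) atTop (𝓝 c) := by
  obtain ⟨V, hV, hlim⟩ := hρ.tendsto_ncard_modEq
  obtain ⟨C, hC, hbound⟩ := hρ.ncard_dvd_le
  have hM' : (0 : ℝ) < M := by exact_mod_cast hM
  set E : ℕ → ℝ → Set (ℤ × ℤ) := fun d r => {l : ℤ × ℤ | l ≠ 0 ∧ (d : ℤ) ∣ l.1 ∧ (d : ℤ) ∣ l.2 ∧
    l ∈ {l : ℤ × ℤ | l.1 ≡ a [ZMOD M] ∧ l.2 ≡ b [ZMOD M] ∧ ρ l.1 l.2 ≤ r}} with hE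
  set g : ℕ → ℝ := fun d => if Nat.Coprime M d then V / ((M : ℝ) * d) ^ 2 else 0 with hg
  have hElim (d : ℕ) (hd : 0 < d) : Tendsto (fun r : ℝ => ((E d r).ncard : ℝ) / r ^ 2) atTop
      (𝓝 (g d)) := by
    by_cases hc : Nat.Coprime M d
    · obtain ⟨u, v, huv⟩ := Nat.isCoprime_iff_coprime.mpr hc
      have hlim' := hlim (M * d) (Nat.mul_pos hM hd) (a * (v * d)) (b * (v * d))
      simp only [hg, if_pos hc]
      push_cast at hlim'
      have hkey (x a : ℤ) : x ≡ a * (v * d) [ZMOD M * d] ↔ (d : ℤ) ∣ x ∧ x ≡ a [ZMOD M] := by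
        rw [← Int.modEq_and_modEq_iff_modEq_mul (by simpa using hc)]
        have h1 : a * (v * d) ≡ a [ZMOD M] := by
          refine Int.ModEq.symm ((Int.modEq_iff_dvd).mpr ⟨-(a * u), ?_⟩)
          linear_combination a * huv
        have h2 : a * (v * d) ≡ 0 [ZMOD d] := (Int.modEq_zero_iff_dvd).mpr ⟨a * v, by ring⟩
        rw [← Int.modEq_zero_iff_dvd]
        exact ⟨fun h => ⟨h.2.trans h2, h.1.trans h1⟩,
          fun h => ⟨h.2.trans h1.symm, h.1.trans h2.symm⟩⟩
      set s : ℝ → Set (ℤ × ℤ) := fun r => {l : ℤ × ℤ | l.1 ≡ a * (v * d) [ZMOD M * d] ∧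
        l.2 ≡ b * (v * d) [ZMOD M * d] ∧ ρ l.1 l.2 ≤ r} with hs
      have hEs (r : ℝ) : E d r = s r \ {0} := by
        ext l
        simp only [hE, hs, hkey, Set.mem_ofPred_eq, Set.mem_sdiff, Set.mem_singleton_iff]
        tauto
      have hsf (r : ℝ) : (s r).Finite := (hρ.finite_le r).subset fun l hl => hl.2.2
      have h0 : Tendsto (fun r : ℝ => ((s r).ncard : ℝ) / r ^ 2 - 1 / r ^ 2) atTop
          (𝓝 (V / ((M : ℝ) * d) ^ 2 - 0)) :=
        hlim'.sub (tendsto_const_nhds.div_atTop (tendsto_pow_atTop two_ne_zero))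
      rw [sub_zero] at h0
      refine tendsto_of_tendsto_of_tendsto_of_le_of_le h0 hlim' ?_ ?_
      · intro r
        dsimp only
        rw [hEs, ← sub_div]
        refine div_le_div_of_nonneg_right ?_ (sq_nonneg r)
        rw [sub_le_iff_le_add]
        exact_mod_cast (Set.ncard_le_ncard_sdiff_add_ncard (s r) {0} (Set.finite_singleton _)).trans
          (by simp)
      · intro r
        dsimp only
        rw [hEs]
        exact div_le_div_of_nonneg_right (Nat.cast_le.mpr (Set.ncard_le_ncard Set.sdiff_subset
          (hsf r))) (sq_nonneg r)
    · have hempty (r : ℝ) : E d r = ∅ := by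
        rw [Set.eq_empty_iff_forall_notMem]
        rintro l ⟨-, h1, h2, h3, h4, -⟩
        obtain ⟨m, hm, hma, hmb⟩ := hab
        obtain ⟨p, hp, hpM, hpd⟩ := Nat.Prime.not_coprime_iff_dvd.mp hc
        have hpM' : (p : ℤ) ∣ M := Int.natCast_dvd_natCast.mpr hpM
        have hpd' : (p : ℤ) ∣ d := Int.natCast_dvd_natCast.mpr hpd
        have e (x y z : ℤ) (hx : x ≡ z [ZMOD M]) (hy : y ≡ z [ZMOD M]) (hd : (d : ℤ) ∣ y) :
            (p : ℤ) ∣ x := by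
          have := ((hx.trans hy.symm).of_dvd hpM').dvd
          exact (dvd_sub_right (hpd'.trans hd)).mp this
        have hu := hm.isUnit_of_dvd' (e _ _ _ hma h3 h1) (e _ _ _ hmb h4 h2)
        exact hp.one_lt.ne' (Int.ofNat_isUnit.mp hu |> Nat.isUnit_iff.mp)
      simp only [hempty, Set.ncard_empty, hg, if_neg hc]
      simp
  set μ : ℕ → ℝ := fun d => (ArithmeticFunction.moebius d : ℝ) with hμ
  have hμ1 (d : ℕ) : |μ d| ≤ 1 := by
    simp only [hμ]; exact_mod_cast ArithmeticFunction.abs_moebius_le_one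
  have hμ0 : μ 0 = 0 := by simp [hμ]
  have hmain : Tendsto (fun r : ℝ => ∑' d, μ d * (((E d r).ncard : ℝ) / r ^ 2)) atTop
      (𝓝 (∑' d, μ d * g d)) := by
    refine tendsto_tsum_of_dominated_convergence (bound := fun d : ℕ => C * (1 / (d : ℝ) ^ 2))
      ((Real.summable_one_div_nat_pow.mpr one_lt_two).mul_left C) ?_ ?_
    · intro d
      rcases Nat.eq_zero_or_pos d with rfl | hd
      · simp [hμ0]
      · exact (hElim d hd).const_mul _
    · filter_upwards [eventually_gt_atTop 0] with r hr d
      rw [norm_mul, Real.norm_eq_abs, Real.norm_eq_abs,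
        abs_of_nonneg (by positivity : 0 ≤ ((E d r).ncard : ℝ) / r ^ 2)]
      refine (mul_le_of_le_one_left (by positivity) (hμ1 d)).trans ?_
      rw [div_le_iff₀ (by positivity)]
      have h1 : ((E d r).ncard : ℝ) ≤ C * (r ^ 2 / d ^ 2) := by
        refine le_trans ?_ (hbound d r)
        refine Nat.cast_le.mpr
          (Set.ncard_le_ncard ?_ ((hρ.finite_le r).subset fun l hl => hl.2.2.2))
        exact fun l hl => ⟨hl.1, hl.2.1, hl.2.2.1, hl.2.2.2.2.2⟩
      calc _ ≤ _ := h1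
        _ = _ := by ring
  refine ⟨∑' d, μ d * g d, ?_, hmain.congr fun r => ?_⟩
  · have hle (d : ℕ) : |μ d * g d| ≤ V / M ^ 2 * (1 / (d : ℝ) ^ 2) := by
      have h1 : |g d| ≤ V / M ^ 2 * (1 / (d : ℝ) ^ 2) := by
        simp only [hg]
        split_ifs
        · rw [abs_of_nonneg (by positivity), mul_pow, div_mul_div_comm, mul_one]
        · rw [abs_zero]; positivity
      rw [abs_mul]
      exact (mul_le_of_le_one_left (abs_nonneg _) (hμ1 d)).trans h1
    have hz := hasSum_zeta_two.mul_left (V / (M : ℝ) ^ 2)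
    have hs : Summable fun d => μ d * g d := Summable.of_norm_bounded hz.summable hle
    have h2 := (hs.add hz.summable).le_tsum 1 fun d _ => by
      linarith [neg_abs_le (μ d * g d), hle d]
    rw [hs.tsum_add hz.summable, hz.tsum_eq] at h2
    have h3 : μ 1 * g 1 = V / M ^ 2 := by simp [hμ, hg]
    rw [h3] at h2
    have h4 : (Real.pi ^ 2 / 6) < 2 := by nlinarith [Real.pi_lt_d2, Real.pi_pos]
    have h5 : 0 < V / (M : ℝ) ^ 2 := by positivity
    norm_num at h2
    nlinarith
  · obtain ⟨D, hD, hsum⟩ := ncard_isCoprime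
      {l : ℤ × ℤ | l.1 ≡ a [ZMOD M] ∧ l.2 ≡ b [ZMOD M] ∧ ρ l.1 l.2 ≤ r}
      ((hρ.finite_le r).subset fun l hl => hl.2.2)
    rw [tsum_eq_sum (s := Finset.range D)]
    · have hsum' := congrArg (fun z : ℤ => (z : ℝ)) hsum
      simp only [Int.cast_natCast, Int.cast_sum, Int.cast_mul] at hsum'
      simp only [Set.mem_ofPred_eq] at hsum'
      rw [hsum', Finset.sum_div]
      exact Finset.sum_congr rfl fun d _ => (mul_div_assoc _ _ _).symm
    · intro d hd
      have : E d r = ∅ := hD d (by simpa using hd)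
      simp [this]

end PlaneGauge

open MeasureTheory in
/-- Partial summation: if the weighted counting function of `F` is asymptotic to `c * X`, then the
sum of the weights divided by `F` is asymptotic to `c * log X`. -/
lemma tendsto_sum_div_div_log {ι : Type*} (P : ι → Prop) (F w : ι → ℝ) (s : ℝ → Finset ι)
    (hs : ∀ X i, i ∈ s X ↔ P i ∧ F i ≤ X) (f₀ : ℝ) (hf₀ : 0 < f₀) (hF : ∀ i, P i → f₀ < F i)
    (hw : ∀ i, 0 ≤ w i) (c : ℝ)
    (hc : Tendsto (fun X : ℝ => (∑ i ∈ s X, w i) / X) atTop (𝓝 c)) :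
    Tendsto (fun X : ℝ => (∑ i ∈ s X, w i / F i) / Real.log X) atTop (𝓝 c) := by
  classical
  set n : ℝ → ℝ := fun X => ∑ i ∈ s X, w i with hn
  have hmono : Monotone n := by
    intro X Y hXY
    refine Finset.sum_le_sum_of_subset_of_nonneg ?_ fun i _ _ => hw i
    intro i hi
    rw [hs] at hi ⊢
    exact ⟨hi.1, hi.2.trans hXY⟩
  have hcont {a b : ℝ} (ha : 0 < a) (hab : a ≤ b) :
      ContinuousOn (fun t : ℝ => (t ^ 2)⁻¹) (Set.uIcc a b) := by
    rw [Set.uIcc_of_le hab]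
    refine ContinuousOn.inv₀ (by fun_prop) fun t ht => ?_
    have : 0 < t := ha.trans_le ht.1
    positivity
  have hinv_int {a b : ℝ} (ha : 0 < a) (hab : a ≤ b) :
      IntervalIntegrable (fun t => n t * (t ^ 2)⁻¹) volume a b :=
    hmono.intervalIntegrable.mul_continuousOn (hcont ha hab)
  have hsq {a b : ℝ} (ha : 0 < a) (hab : a ≤ b) : ∫ t in a..b, (t ^ 2)⁻¹ = a⁻¹ - b⁻¹ := by
    have hd : ∀ t ∈ Set.uIcc a b, HasDerivAt (fun t : ℝ => -t⁻¹) ((t ^ 2)⁻¹) t := by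
      intro t ht
      rw [Set.uIcc_of_le hab] at ht
      have h0 : t ≠ 0 := (ha.trans_le ht.1).ne'
      have h := (hasDerivAt_inv h0).fun_neg
      rwa [neg_neg] at h
    rw [intervalIntegral.integral_eq_sub_of_hasDerivAt hd (hcont ha hab).intervalIntegrable]
    ring
  have hid (X : ℝ) (hX : f₀ ≤ X) :
      ∑ i ∈ s X, w i / F i = n X / X + ∫ t in f₀..X, n t * (t ^ 2)⁻¹ := by
    have hX0 : 0 < X := hf₀.trans_le hX
    have h1 : ∫ t in f₀..X, n t * (t ^ 2)⁻¹ =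
        ∫ t in f₀..X, ∑ i ∈ s X, w i * (Set.Ici (F i)).indicator (fun t => (t ^ 2)⁻¹) t := by
      refine intervalIntegral.integral_congr fun t ht => ?_
      rw [Set.uIcc_of_le hX] at ht
      have h2 : s t = (s X).filter fun i => F i ≤ t := by
        ext i
        simp only [hs, Finset.mem_filter]
        exact ⟨fun h => ⟨⟨h.1, h.2.trans ht.2⟩, h.2⟩, fun h => ⟨h.1.1, h.2⟩⟩
      simp only [hn]
      rw [h2, Finset.sum_filter, Finset.sum_mul]
      refine Finset.sum_congr rfl fun i _ => ?_
      simp only [Set.indicator, Set.mem_Ici]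
      split_ifs <;> ring
    have hi2 (i : ι) : IntervalIntegrable
        (fun t => w i * (Set.Ici (F i)).indicator (fun t : ℝ => (t ^ 2)⁻¹) t) volume f₀ X := by
      refine IntervalIntegrable.const_mul ?_ _
      have := (hcont hf₀ hX).intervalIntegrable (μ := volume)
      rw [intervalIntegrable_iff] at this ⊢
      exact this.indicator measurableSet_Ici
    rw [h1, intervalIntegral.integral_finsetSum fun i _ => hi2 i]
    simp only [hn]
    rw [Finset.sum_div, ← Finset.sum_add_distrib]
    refine Finset.sum_congr rfl fun i hi => ?_
    obtain ⟨hPi, hiX⟩ := (hs X i).mp hi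
    have hfi := hF i hPi
    have hset : Set.Ici (F i) ∩ Set.Ioc f₀ X = Set.Icc (F i) X := by
      ext t
      simp only [Set.mem_inter_iff, Set.mem_Ici, Set.mem_Ioc, Set.mem_Icc]
      exact ⟨fun h => ⟨h.1, h.2.2⟩, fun h => ⟨h.1, hfi.trans_le h.1, h.2⟩⟩
    rw [intervalIntegral.integral_const_mul, intervalIntegral.integral_of_le hX,
      integral_indicator measurableSet_Ici, Measure.restrict_restrict measurableSet_Ici, hset,
      integral_Icc_eq_integral_Ioc, ← intervalIntegral.integral_of_le hiX,
      hsq (hf₀.trans hfi) hiX]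
    ring
  have hlog := Real.tendsto_log_atTop
  have hI : Tendsto (fun X : ℝ => (∫ t in f₀..X, n t * (t ^ 2)⁻¹) / Real.log X) atTop (𝓝 c) := by
    rw [Metric.tendsto_atTop] at hc
    rw [Metric.tendsto_atTop']
    intro ε hε
    obtain ⟨X₁, hX₁⟩ := hc (ε / 2) (by positivity)
    set X₀ := max (max X₁ f₀) 1 with hX₀
    have hX₀1 : 1 ≤ X₀ := le_max_right _ _
    have hX₀f : f₀ ≤ X₀ := (le_max_right _ _).trans (le_max_left _ _)
    have hX₀X : X₁ ≤ X₀ := (le_max_left _ _).trans (le_max_left _ _)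
    have hX₀p : 0 < X₀ := by linarith
    set B := |∫ t in f₀..X₀, n t * (t ^ 2)⁻¹| + |c| * Real.log X₀ with hB
    have hlogX₀ : 0 ≤ Real.log X₀ := Real.log_nonneg hX₀1
    have hB0 : 0 ≤ B := by positivity
    obtain ⟨Y, hY⟩ := Filter.eventually_atTop.mp (hlog.eventually_gt_atTop (2 * B / ε))
    refine ⟨max Y (max X₀ 1), fun X hX => ?_⟩
    have hXY : Y ≤ X := (le_max_left _ _).trans hX.le
    have hXX : X₀ ≤ X := (le_max_left _ _).trans ((le_max_right _ _).trans hX.le)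
    have hX1 : 1 < X := ((le_max_right _ _).trans (le_max_right _ _)).trans_lt hX
    have hlX : 0 < Real.log X := Real.log_pos hX1
    have hsplit := intervalIntegral.integral_add_adjacent_intervals (hinv_int hf₀ hX₀f)
      (hinv_int hX₀p hXX)
    have hbd : ∀ t ∈ Set.Icc X₀ X, (c - ε / 2) * t⁻¹ ≤ n t * (t ^ 2)⁻¹ ∧
        n t * (t ^ 2)⁻¹ ≤ (c + ε / 2) * t⁻¹ := by
      intro t ht
      have ht0 : 0 < t := hX₀p.trans_le ht.1
      have h := hX₁ t (hX₀X.trans ht.1)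
      rw [Real.dist_eq, abs_lt] at h
      have e : n t * (t ^ 2)⁻¹ = n t / t * t⁻¹ := by field_simp
      rw [e]
      exact ⟨mul_le_mul_of_nonneg_right (by linarith [h.1]) (by positivity),
        mul_le_mul_of_nonneg_right (by linarith [h.2]) (by positivity)⟩
    have hinv : ContinuousOn (fun t : ℝ => t⁻¹) (Set.uIcc X₀ X) := by
      rw [Set.uIcc_of_le hXX]
      exact continuousOn_id.inv₀ fun t ht => (hX₀p.trans_le ht.1).ne'
    have hlint : ∫ t in X₀..X, t⁻¹ = Real.log X - Real.log X₀ := by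
      rw [integral_inv_of_pos hX₀p (by linarith), Real.log_div (by linarith) (by linarith)]
    have hlo := intervalIntegral.integral_mono_on hXX
      (hinv.intervalIntegrable.const_mul (c - ε / 2)) (hinv_int hX₀p hXX) fun t ht => (hbd t ht).1
    have hhi := intervalIntegral.integral_mono_on hXX (hinv_int hX₀p hXX)
      (hinv.intervalIntegrable.const_mul (c + ε / 2)) fun t ht => (hbd t ht).2
    rw [intervalIntegral.integral_const_mul, hlint] at hlo hhi
    have hBX : B < ε / 2 * Real.log X := by
      have := hY X hXY
      rw [div_lt_iff₀ hε] at this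
      linarith
    rw [Real.dist_eq, ← hsplit, abs_lt, lt_sub_iff_add_lt, sub_lt_iff_lt_add, lt_div_iff₀ hlX,
      div_lt_iff₀ hlX]
    have h1 := neg_abs_le (∫ t in f₀..X₀, n t * (t ^ 2)⁻¹)
    have h2 := le_abs_self (∫ t in f₀..X₀, n t * (t ^ 2)⁻¹)
    have h3 := mul_le_mul_of_nonneg_right (le_abs_self c) hlogX₀
    have h4 := mul_le_mul_of_nonneg_right (neg_abs_le c) hlogX₀
    have h5 : 0 ≤ ε / 2 * Real.log X₀ := by positivity
    constructor <;> nlinarith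
  have hfin : Tendsto (fun X : ℝ => n X / X / Real.log X +
      (∫ t in f₀..X, n t * (t ^ 2)⁻¹) / Real.log X) atTop (𝓝 (0 + c)) :=
    (hc.div_atTop hlog).add hI
  rw [zero_add] at hfin
  refine hfin.congr' ?_
  filter_upwards [eventually_ge_atTop f₀] with X hX
  rw [hid X hX, add_div]

namespace PlaneGauge

variable {ρ : ℝ → ℝ → ℝ}

/-- The logarithmic asymptotics of a periodically weighted sum over primitive lattice points. -/
lemma tendsto_sum_div_sq_div_log (hρ : PlaneGauge ρ) (M : ℕ) (hM : 0 < M) (w : ℤ → ℤ → ℝ)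
    (hw : ∀ a b, 0 ≤ w a b)
    (hper : ∀ a b a' b', a ≡ a' [ZMOD M] → b ≡ b' [ZMOD M] → w a b = w a' b')
    (hpos : ∃ l : ℤ × ℤ, IsCoprime l.1 l.2 ∧ 0 < w l.1 l.2) (s : ℝ → Finset (ℤ × ℤ))
    (hs : ∀ r l, l ∈ s r ↔ IsCoprime l.1 l.2 ∧ ρ l.1 l.2 ≤ r) :
    ∃ c > 0, Tendsto (fun r : ℝ => (∑ l ∈ s r, w l.1 l.2 / ρ l.1 l.2 ^ 2) / Real.log r)
      atTop (𝓝 c) := by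
  classical
  have hM0 : (M : ℤ) ≠ 0 := by exact_mod_cast hM.ne'
  set cls : ℤ × ℤ → ℤ × ℤ := fun l => (l.1 % M, l.2 % M) with hcls
  set R : Finset (ℤ × ℤ) := Finset.Ico 0 (M : ℤ) ×ˢ Finset.Ico 0 (M : ℤ) with hR
  have hmaps (l : ℤ × ℤ) : cls l ∈ R := by
    simp only [hcls, hR, Finset.mem_product, Finset.mem_Ico]
    have hM1 : (0 : ℤ) < M := by exact_mod_cast hM
    exact ⟨⟨Int.emod_nonneg _ hM0, Int.emod_lt_of_pos _ hM1⟩,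
      ⟨Int.emod_nonneg _ hM0, Int.emod_lt_of_pos _ hM1⟩⟩
  have hclass : ∀ x ∈ R, ∃ c : ℝ, 0 ≤ c ∧ ((∃ l : ℤ × ℤ, IsCoprime l.1 l.2 ∧ cls l = x) → 0 < c) ∧
      Tendsto (fun r : ℝ => (((s r).filter fun l => cls l = x).card : ℝ) / r ^ 2) atTop (𝓝 c) := by
    intro x hx
    simp only [hR, Finset.mem_product, Finset.mem_Ico] at hx
    have hx1 : x.1 % (M : ℤ) = x.1 := Int.emod_eq_of_lt hx.1.1 hx.1.2
    have hx2 : x.2 % (M : ℤ) = x.2 := Int.emod_eq_of_lt hx.2.1 hx.2.2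
    have hiff (l : ℤ × ℤ) : cls l = x ↔ l.1 ≡ x.1 [ZMOD M] ∧ l.2 ≡ x.2 [ZMOD M] := by
      simp only [hcls, Prod.ext_iff, Int.ModEq, hx1, hx2]
    by_cases hex : ∃ l : ℤ × ℤ, IsCoprime l.1 l.2 ∧ cls l = x
    · obtain ⟨c, hc, hlim⟩ := hρ.tendsto_ncard_isCoprime_modEq M hM x.1 x.2
        (by simpa only [hiff] using hex)
      refine ⟨c, hc.le, fun _ => hc, hlim.congr fun r => ?_⟩
      congr 2
      rw [← Set.ncard_coe_finset]
      congr 1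
      ext l
      simp only [Finset.coe_filter, Set.mem_ofPred_eq, hs, hiff]
      tauto
    · refine ⟨0, le_rfl, fun h => absurd h hex, ?_⟩
      refine tendsto_const_nhds.congr fun r => ?_
      rw [Finset.filter_eq_empty_iff.mpr, Finset.card_empty, Nat.cast_zero, zero_div]
      exact fun l hl h => hex ⟨l, ((hs r l).mp hl).1, h⟩
  choose! c hc0 hcpos hclim using hclass
  have hsum (r : ℝ) : ∑ l ∈ s r, w l.1 l.2 =
      ∑ x ∈ R, w x.1 x.2 * (((s r).filter fun l => cls l = x).card : ℝ) := by
    rw [← Finset.sum_fiberwise_of_maps_to (g := cls) (t := R) fun l _ => hmaps l]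
    refine Finset.sum_congr rfl fun x _ => ?_
    rw [mul_comm, ← nsmul_eq_mul, ← Finset.sum_const]
    refine Finset.sum_congr rfl fun l hl => ?_
    rw [← (Finset.mem_filter.mp hl).2]
    exact hper _ _ _ _ (Int.mod_modEq _ _).symm (Int.mod_modEq _ _).symm
  have hlim : Tendsto (fun r : ℝ => (∑ l ∈ s r, w l.1 l.2) / r ^ 2) atTop
      (𝓝 (∑ x ∈ R, w x.1 x.2 * c x)) := by
    have := tendsto_finsetSum R fun x hx => (hclim x hx).const_mul (w x.1 x.2)
    refine this.congr fun r => ?_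
    rw [hsum, Finset.sum_div]
    exact Finset.sum_congr rfl fun x _ => (mul_div_assoc _ _ _).symm
  have hcp : 0 < ∑ x ∈ R, w x.1 x.2 * c x := by
    obtain ⟨l, hl, hwl⟩ := hpos
    refine Finset.sum_pos' (fun x hx => mul_nonneg (hw _ _) (hc0 x hx)) ⟨cls l, hmaps l, ?_⟩
    refine mul_pos ?_ (hcpos _ (hmaps l) ⟨l, hl, rfl⟩)
    rwa [hper _ _ l.1 l.2 (Int.mod_modEq _ _) (Int.mod_modEq _ _)]
  obtain ⟨κ, hκ, hlow⟩ := hρ.lower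
  have hρκ (l : ℤ × ℤ) (hl : IsCoprime l.1 l.2) : κ ≤ ρ l.1 l.2 := by
    have h0 : l ≠ 0 := by
      rintro rfl
      exact not_isCoprime_zero_zero hl
    nlinarith [hlow l.1 l.2, one_le_abs_add_abs h0]
  have key := tendsto_sum_div_div_log (fun l : ℤ × ℤ => IsCoprime l.1 l.2)
    (fun l => ρ l.1 l.2 ^ 2) (fun l => w l.1 l.2)
    (fun X => (s (Real.sqrt X)).filter fun l => ρ l.1 l.2 ^ 2 ≤ X) ?_ (κ ^ 2 / 2) (by positivity)
    ?_ (fun l => hw _ _) (∑ x ∈ R, w x.1 x.2 * c x) ?_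
  · refine ⟨2 * ∑ x ∈ R, w x.1 x.2 * c x, by positivity, ?_⟩
    have h2 := (key.comp (tendsto_pow_atTop (α := ℝ) two_ne_zero)).const_mul 2
    refine h2.congr' ?_
    filter_upwards [eventually_gt_atTop 1] with r hr
    have hr0 : 0 ≤ r := by linarith
    simp only [Function.comp, Real.sqrt_sq hr0, Real.log_pow]
    rw [Finset.filter_true_of_mem]
    · push_cast
      rw [mul_div_assoc', mul_div_mul_left _ _ two_ne_zero]
    · exact fun l hl => pow_le_pow_left₀ (hρ.nonneg _ _) ((hs r l).mp hl).2 2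
  · intro X l
    rw [Finset.mem_filter, hs]
    exact ⟨fun h => ⟨h.1.1, h.2⟩, fun h => ⟨⟨h.1, Real.le_sqrt_of_sq_le h.2⟩, h.2⟩⟩
  · intro l hl
    have := pow_le_pow_left₀ hκ.le (hρκ l hl) 2
    have h2 : 0 < κ ^ 2 := by positivity
    linarith
  · have h2 := hlim.comp Real.tendsto_sqrt_atTop
    refine h2.congr' ?_
    filter_upwards [eventually_ge_atTop 0] with X hX
    simp only [Function.comp, Real.sq_sqrt hX]
    rw [Finset.filter_true_of_mem]
    intro l hl
    have := pow_le_pow_left₀ (hρ.nonneg _ _) ((hs _ l).mp hl).2 2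
    rwa [Real.sq_sqrt hX] at this

end PlaneGauge

/-- A definite seminorm on `ℝ³` is equivalent to the sup norm. -/
lemma exists_seminorm_bounds (G : Seminorm ℝ (Fin 3 → ℝ)) (hG : ∀ v, G v = 0 → v = 0) :
    ∃ κ > 0, ∃ K > 0, ∀ v, κ * ‖v‖ ≤ G v ∧ G v ≤ K * ‖v‖ := by
  have hup (v : Fin 3 → ℝ) : G v ≤ (∑ i, G (Pi.single i 1) + 1) * ‖v‖ := by
    have h1 : v = ∑ i, v i • (Pi.single i 1 : Fin 3 → ℝ) := pi_eq_sum_univ' v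
    have h2 : G v ≤ ∑ i, ‖v‖ * G (Pi.single i 1) := by
      conv_lhs => rw [h1]
      refine (Finset.le_sum_of_subadditive G (map_zero G).le (map_add_le_add G) _ _).trans
        (Finset.sum_le_sum fun i _ => ?_)
      rw [map_smul_eq_mul]
      exact mul_le_mul_of_nonneg_right (norm_le_pi_norm v i) (apply_nonneg G _)
    rw [← Finset.mul_sum] at h2
    nlinarith [norm_nonneg v]
  have hS : 0 ≤ ∑ i, G (Pi.single i 1 : Fin 3 → ℝ) := Finset.sum_nonneg fun i _ => apply_nonneg G _
  have hcont : Continuous G := by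
    refine (LipschitzWith.of_dist_le_mul (K := ⟨∑ i, G (Pi.single i 1) + 1, by positivity⟩)
      fun v w => ?_).continuous
    rw [Real.dist_eq, dist_eq_norm]
    exact (abs_sub_map_le_sub G v w).trans (hup _)
  obtain ⟨v₀, hv₀, hmin⟩ := (isCompact_sphere (0 : Fin 3 → ℝ) 1).exists_isMinOn
    (NormedSpace.sphere_nonempty.mpr zero_le_one) hcont.continuousOn
  have hv1 : ‖v₀‖ = 1 := by simpa using hv₀
  refine ⟨G v₀, (apply_nonneg G v₀).lt_of_ne fun h => ?_, _, by positivity, fun v => ⟨?_, hup v⟩⟩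
  · rw [hG v₀ h.symm] at hv1
    simp at hv1
  · by_cases hv : v = 0
    · simp [hv]
    have hv' : 0 < ‖v‖ := norm_pos_iff.mpr hv
    have h1 : ‖v‖⁻¹ • v ∈ Metric.sphere (0 : Fin 3 → ℝ) 1 := by
      simp [norm_smul, hv'.ne']
    have h2 : G v₀ ≤ G (‖v‖⁻¹ • v) := hmin h1
    rw [map_smul_eq_mul, norm_inv, norm_norm, inv_mul_eq_div, le_div_iff₀ hv'] at h2
    exact h2

/-- The coefficients of the product of two binary linear forms. -/
def binProd {R : Type*} [CommRing R] (l m : R × R) : Fin 3 → R :=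
  ![l.1 * m.1, l.1 * m.2 + l.2 * m.1, l.2 * m.2]

lemma norm_binProd_le (l m : ℝ × ℝ) :
    ‖binProd l m‖ ≤ (|l.1| + |l.2|) * (|m.1| + |m.2|) := by
  rw [pi_norm_le_iff_of_nonneg (by positivity)]
  have h1 := abs_nonneg l.1
  have h2 := abs_nonneg l.2
  have h3 := abs_nonneg m.1
  have h4 := abs_nonneg m.2
  have h5 := abs_add_le (l.1 * m.2) (l.2 * m.1)
  rw [abs_mul, abs_mul] at h5
  intro i
  fin_cases i <;> simp [binProd] <;> nlinarith [mul_nonneg h1 h3, mul_nonneg h1 h4,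
    mul_nonneg h2 h3, mul_nonneg h2 h4]

lemma sq_mul_sq_le_norm_binProd (l m : ℝ × ℝ) :
    (l.1 ^ 2 + l.2 ^ 2) * (m.1 ^ 2 + m.2 ^ 2) ≤ 9 * ‖binProd l m‖ ^ 2 := by
  have h0 := norm_le_pi_norm (binProd l m) 0
  have h1 := norm_le_pi_norm (binProd l m) 1
  have h2 := norm_le_pi_norm (binProd l m) 2
  simp only [binProd, Real.norm_eq_abs, cons_val_zero, cons_val_one, cons_val] at h0 h1 h2
  rw [← binProd] at h0 h1 h2
  set n := ‖binProd l m‖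
  have h0' := sq_le_sq' (abs_le.mp h0).1 (abs_le.mp h0).2
  have h1' := sq_le_sq' (abs_le.mp h1).1 (abs_le.mp h1).2
  have h2' := sq_le_sq' (abs_le.mp h2).1 (abs_le.mp h2).2
  nlinarith [sq_nonneg (l.1 * m.1 + l.2 * m.2), sq_nonneg n]

lemma binProd_add_right {R : Type*} [CommRing R] (l m m' : R × R) :
    binProd l (m + m') = binProd l m + binProd l m' := by
  ext i; fin_cases i <;> simp [binProd] <;> ring

lemma binProd_smul_right {R : Type*} [CommRing R] (l m : R × R) (t : R) :
    binProd l (t • m) = t • binProd l m := by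
  ext i; fin_cases i <;> simp [binProd] <;> ring

lemma planeGauge_sqrt (G : Seminorm ℝ (Fin 3 → ℝ)) (hG : ∀ v, G v = 0 → v = 0) :
    PlaneGauge fun x y => √(G (binProd (x, y) (x, y))) := by
  obtain ⟨κ, hκ, K, hK, hb⟩ := exists_seminorm_bounds G hG
  have hlow (x y : ℝ) : √κ / 3 * (|x| + |y|) ≤ √(G (binProd (x, y) (x, y))) := by
    refine Real.le_sqrt_of_sq_le ?_
    have h1 := sq_mul_sq_le_norm_binProd (x, y) (x, y)
    have h2 := (hb (binProd (x, y) (x, y))).1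
    have h3 : x ^ 2 + y ^ 2 ≤ 3 * ‖binProd (x, y) (x, y)‖ := by
      refine le_of_sq_le_sq ?_ (by positivity)
      simp only at h1
      nlinarith
    rw [mul_pow, div_pow, Real.sq_sqrt hκ.le]
    have h4 : (|x| + |y|) ^ 2 ≤ 2 * (x ^ 2 + y ^ 2) := by
      nlinarith [sq_nonneg (|x| - |y|), sq_abs x, sq_abs y]
    nlinarith
  refine ⟨fun t x y ht => ?_, ?_, √κ / 3, by positivity, hlow⟩
  · have : binProd (t * x, t * y) (t * x, t * y) = t ^ 2 • binProd (x, y) (x, y) := by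
      ext i; fin_cases i <;> simp [binProd] <;> ring
    simp only [this]
    rw [map_smul_eq_mul, Real.norm_of_nonneg (by positivity), Real.sqrt_mul (by positivity),
      Real.sqrt_sq ht]
  · refine ⟨3 * K / √κ + K + 1, fun x y h k => Real.sqrt_le_iff.mpr ⟨by positivity, ?_⟩⟩
    have e : binProd (x + h, y + k) (x + h, y + k) = binProd (x, y) (x, y) +
        ((2 : ℝ) • binProd (x, y) (h, k) + binProd (h, k) (h, k)) := by
      ext i; fin_cases i <;> simp [binProd] <;> ring
    rw [e]
    set r := √(G (binProd (x, y) (x, y))) with hr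
    have hr2 : G (binProd (x, y) (x, y)) = r ^ 2 := (Real.sq_sqrt (apply_nonneg G _)).symm
    have h1 := map_add_le_add G (binProd (x, y) (x, y))
      ((2 : ℝ) • binProd (x, y) (h, k) + binProd (h, k) (h, k))
    have h2 := map_add_le_add G ((2 : ℝ) • binProd (x, y) (h, k)) (binProd (h, k) (h, k))
    rw [map_smul_eq_mul, Real.norm_two] at h2
    have h3 := (hb (binProd (x, y) (h, k))).2
    have h4 := (hb (binProd (h, k) (h, k))).2
    have h5 := norm_binProd_le (x, y) (h, k)
    have h6 := norm_binProd_le (h, k) (h, k)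
    have h7 := hlow x y
    rw [← hr] at h7
    simp only at h5 h6
    set η := |h| + |k|
    have hη : 0 ≤ η := by positivity
    have hr0 : 0 ≤ r := Real.sqrt_nonneg _
    have hsκ : 0 < √κ := Real.sqrt_pos.mpr hκ
    have h8 : |x| + |y| ≤ 3 / √κ * r := by
      rw [div_mul_eq_mul_div, le_div_iff₀ hsκ]
      linarith
    have h9 : G (binProd (x, y) (h, k)) ≤ 3 * K / √κ * r * η := by
      calc _ ≤ K * ((|x| + |y|) * η) := h3.trans (by gcongr)
        _ ≤ K * ((3 / √κ * r) * η) := by gcongr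
        _ = _ := by ring
    have h10 : G (binProd (h, k) (h, k)) ≤ K * (η * η) := h4.trans (by gcongr)
    have h11 : 0 ≤ 3 * K / √κ := by positivity
    set L := 3 * K / √κ
    have : K ≤ (L + K + 1) ^ 2 := by nlinarith
    have h12 : K * (η * η) ≤ (L + K + 1) ^ 2 * (η * η) := by gcongr
    have h13 : 0 ≤ (K + 1) * r * η := by positivity
    nlinarith

/-- Integers in an interval of length `2 * X` lying in a set periodic modulo `M`. -/
lemma abs_ncard_periodic_sub_le (M : ℕ) (hM : 0 < M) (W : Set ℤ)
    (hW : ∀ a b : ℤ, a ≡ b [ZMOD M] → a ∈ W → b ∈ W) (x X : ℝ) :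
    ({t : ℤ | t ∈ W ∧ |t + x| < X}.ncard : ℝ) ≥
        2 * X * (({t : ℤ | t ∈ W ∧ 0 ≤ t ∧ t < M}.ncard : ℝ) / M) - 2 * M ∧
      (0 ≤ X → ({t : ℤ | t ∈ W ∧ |t + x| < X}.ncard : ℝ) ≤
        2 * X * (({t : ℤ | t ∈ W ∧ 0 ≤ t ∧ t < M}.ncard : ℝ) / M) + 2 * M) := by
  classical
  have hM' : (0 : ℤ) < M := by exact_mod_cast hM
  have hMR : (1 : ℝ) ≤ M := by exact_mod_cast hM
  set R : Finset ℤ := (Finset.Ico 0 (M : ℤ)).filter (· ∈ W) with hR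
  have e1 : {t : ℤ | t ∈ W ∧ 0 ≤ t ∧ t < M} = (R : Set ℤ) := by
    ext t; simp [hR, and_comm]
  set a : ℤ := ⌊-x - X⌋ + 1 with ha
  set b : ℤ := ⌈-x + X⌉ with hb
  have e2 : {t : ℤ | t ∈ W ∧ |t + x| < X} = ((Finset.Ico a b).filter (· ∈ W) : Finset ℤ) := by
    ext t
    simp only [Set.mem_ofPred_eq, Finset.coe_filter, Finset.mem_Ico, abs_lt, ha, hb,
      Int.add_one_le_iff, Int.floor_lt, Int.lt_ceil]
    constructor
    · rintro ⟨h1, h2, h3⟩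
      exact ⟨⟨by linarith, by linarith⟩, h1⟩
    · rintro ⟨⟨h1, h2⟩, h3⟩
      exact ⟨h3, by linarith, by linarith⟩
  have e3 : ((Finset.Ico a b).filter (· ∈ W)).card =
      ∑ v ∈ R, ((Finset.Ico a b).filter fun t => t ≡ v [ZMOD M]).card := by
    rw [Finset.card_eq_sum_card_fiberwise (f := fun t => t % (M : ℤ)) (t := R)]
    · refine Finset.sum_congr rfl fun v hv => ?_
      simp only [hR, Finset.mem_filter, Finset.mem_Ico] at hv
      congr 1
      ext t
      have : v % (M : ℤ) = v := Int.emod_eq_of_lt hv.1.1 hv.1.2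
      simp only [Finset.mem_filter, Int.ModEq, this]
      refine ⟨fun h => ⟨h.1.1, h.2⟩, fun h => ⟨⟨h.1, hW v t ?_ hv.2⟩, h.2⟩⟩
      rw [Int.ModEq, h.2, this]
    · intro t ht
      simp only [Finset.coe_filter, Set.mem_ofPred_eq] at ht
      simp only [hR, Finset.coe_filter, Finset.mem_Ico, Set.mem_ofPred_eq]
      exact ⟨⟨Int.emod_nonneg _ hM'.ne', Int.emod_lt_of_pos _ hM'⟩,
        hW t _ (Int.mod_modEq _ _).symm ht.2⟩
  have hcls (v : ℤ) : ((b - a : ℝ) / M - 1 ≤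
      ((Finset.Ico a b).filter fun t => t ≡ v [ZMOD M]).card) ∧ (0 ≤ (b - a : ℝ) / M + 1 →
      (((Finset.Ico a b).filter fun t => t ≡ v [ZMOD M]).card : ℝ) ≤ (b - a : ℝ) / M + 1) := by
    have h := Int.Ico_filter_modEq_card a b hM' v
    have h' : (((Finset.Ico a b).filter fun t => t ≡ v [ZMOD M]).card : ℝ) =
        max ((⌈((b : ℚ) - v) / ((M : ℤ) : ℚ)⌉ : ℝ) - ⌈((a : ℚ) - v) / ((M : ℤ) : ℚ)⌉) 0 := by
      exact_mod_cast congrArg (Int.cast : ℤ → ℝ) h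
    have c1 : (((b : ℚ) - v) / ((M : ℤ) : ℚ) : ℚ) ≤ ⌈((b : ℚ) - v) / ((M : ℤ) : ℚ)⌉ :=
      Int.le_ceil _
    have c2 := (Int.ceil_lt_add_one (((b : ℚ) - v) / ((M : ℤ) : ℚ))).le
    have c3 : (((a : ℚ) - v) / ((M : ℤ) : ℚ) : ℚ) ≤ ⌈((a : ℚ) - v) / ((M : ℤ) : ℚ)⌉ :=
      Int.le_ceil _
    have c4 := (Int.ceil_lt_add_one (((a : ℚ) - v) / ((M : ℤ) : ℚ))).le
    rw [h']
    set β := ⌈((b : ℚ) - v) / ((M : ℤ) : ℚ)⌉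
    set α := ⌈((a : ℚ) - v) / ((M : ℤ) : ℚ)⌉
    have c1' : ((b : ℝ) - v) / M ≤ β := by exact_mod_cast (Rat.cast_le (K := ℝ)).mpr c1
    have c2' : (β : ℝ) ≤ ((b : ℝ) - v) / M + 1 := by exact_mod_cast (Rat.cast_le (K := ℝ)).mpr c2
    have c3' : ((a : ℝ) - v) / M ≤ α := by exact_mod_cast (Rat.cast_le (K := ℝ)).mpr c3
    have c4' : (α : ℝ) ≤ ((a : ℝ) - v) / M + 1 := by exact_mod_cast (Rat.cast_le (K := ℝ)).mpr c4
    have e : ((b : ℝ) - a) / M = ((b : ℝ) - v) / M - ((a : ℝ) - v) / M := by ring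
    rw [e]
    refine ⟨le_max_of_le_left (by linarith), fun h0 => max_le (by linarith) h0⟩
  rw [e1, e2, Set.ncard_coe_finset, Set.ncard_coe_finset, e3]
  push_cast
  have f1 : (R.card : ℝ) ≤ M := by
    have : R.card ≤ (Finset.Ico 0 (M : ℤ)).card := Finset.card_filter_le _ _
    rw [Int.card_Ico, sub_zero, Int.toNat_natCast] at this
    exact_mod_cast this
  have f2 : (R.card : ℝ) / M ≤ 1 := by rw [div_le_one (by linarith)]; exact f1
  have f0 : 0 ≤ (R.card : ℝ) / M := by positivity
  have g1 : (a : ℝ) ≤ -x - X + 1 := by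
    rw [ha]; push_cast; linarith [Int.floor_le (-x - X)]
  have g2 : -x - X < a := by
    rw [ha]; push_cast; linarith [Int.lt_floor_add_one (-x - X)]
  have g3 : -x + X ≤ b := Int.le_ceil _
  have g4 : (b : ℝ) < -x + X + 1 := Int.ceil_lt_add_one _
  constructor
  · have := Finset.card_nsmul_le_sum R _ _ fun v _ => (hcls v).1
    rw [nsmul_eq_mul] at this
    have e : (R.card : ℝ) * ((b - a : ℝ) / M - 1) = (R.card : ℝ) / M * (b - a) - R.card := by ring
    rw [e] at this
    have : (R.card : ℝ) / M * (2 * X - 1) ≤ (R.card : ℝ) / M * (b - a) :=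
      mul_le_mul_of_nonneg_left (by linarith) f0
    linarith
  · intro hX
    have h0 : 0 ≤ (b - a : ℝ) / M + 1 := by
      rw [div_add_one (by positivity)]
      exact div_nonneg (by linarith) (by positivity)
    have := Finset.sum_le_card_nsmul R _ _ fun v _ => (hcls v).2 h0
    rw [nsmul_eq_mul] at this
    have e : (R.card : ℝ) * ((b - a : ℝ) / M + 1) = (R.card : ℝ) / M * (b - a) + R.card := by ring
    rw [e] at this
    have : (R.card : ℝ) / M * (b - a) ≤ (R.card : ℝ) / M * (2 * X + 1) :=
      mul_le_mul_of_nonneg_left (by linarith) f0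
    linarith

lemma cast_binProd (l m : ℤ × ℤ) : (fun i => ((binProd l m i : ℤ) : ℝ)) =
    binProd ((l.1 : ℝ), (l.2 : ℝ)) ((m.1 : ℝ), (m.2 : ℝ)) := by
  ext i; fin_cases i <;> simp [binProd]

/-- The proportion of residues modulo `M` of linear forms `m` of determinant `N` against `(p, q)`
for which the product of the two linear forms lies in `S`. -/
def lineWeight (S : Set (Fin 3 → ℤ)) (N : ℤ) (M : ℕ) (p q : ℤ) : ℝ :=
  ({m : ℤ × ℤ | (0 ≤ m.1 ∧ m.1 < M) ∧ (0 ≤ m.2 ∧ m.2 < M) ∧ p * m.2 - q * m.1 ≡ N [ZMOD M] ∧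
    binProd (p, q) m ∈ S}.ncard : ℝ) / M

lemma lineWeight_nonneg (S : Set (Fin 3 → ℤ)) (N : ℤ) (M : ℕ) (p q : ℤ) :
    0 ≤ lineWeight S N M p q := by
  unfold lineWeight; positivity

lemma binProd_modEq {M : ℤ} {l l' m m' : ℤ × ℤ} (h1 : l.1 ≡ l'.1 [ZMOD M])
    (h2 : l.2 ≡ l'.2 [ZMOD M]) (h3 : m.1 ≡ m'.1 [ZMOD M]) (h4 : m.2 ≡ m'.2 [ZMOD M]) (i : Fin 3) :
    binProd l m i ≡ binProd l' m' i [ZMOD M] := by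
  fin_cases i
  · exact h1.mul h3
  · exact (h1.mul h4).add (h2.mul h3)
  · exact h2.mul h4

lemma lineWeight_congr (S : Set (Fin 3 → ℤ)) (N : ℤ) (M : ℕ)
    (hS : ∀ y y' : Fin 3 → ℤ, (∀ i, y i ≡ y' i [ZMOD M]) → y ∈ S → y' ∈ S) (p q p' q' : ℤ)
    (hp : p ≡ p' [ZMOD M]) (hq : q ≡ q' [ZMOD M]) :
    lineWeight S N M p q = lineWeight S N M p' q' := by
  unfold lineWeight
  congr 3
  ext m
  have h1 : p * m.2 - q * m.1 ≡ p' * m.2 - q' * m.1 [ZMOD M] :=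
    (hp.mul_right _).sub (hq.mul_right _)
  have h2 := binProd_modEq (l := (p, q)) (l' := (p', q')) hp hq (Int.ModEq.refl m.1)
    (Int.ModEq.refl m.2)
  simp only [Set.mem_ofPred_eq]
  exact ⟨fun h => ⟨h.1, h.2.1, h1.symm.trans h.2.2.1, hS _ _ h2 h.2.2.2⟩,
    fun h => ⟨h.1, h.2.1, h1.trans h.2.2.1, hS _ _ (fun i => (h2 i).symm) h.2.2.2⟩⟩

/-- The weight computed along the line of solutions `m = N • b + t • l` of `det (l, m) = N`. -/
lemma lineWeight_eq (S : Set (Fin 3 → ℤ)) (N : ℤ) (M : ℕ) (hM : 0 < M)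
    (hS : ∀ y y' : Fin 3 → ℤ, (∀ i, y i ≡ y' i [ZMOD M]) → y ∈ S → y' ∈ S) (l b : ℤ × ℤ)
    (hlb : l.1 * b.2 - l.2 * b.1 = 1) :
    lineWeight S N M l.1 l.2 =
      ({t : ℤ | t ∈ {t : ℤ | binProd l (N • b + t • l) ∈ S} ∧ 0 ≤ t ∧ t < M}.ncard : ℝ) / M := by
  have hM' : (0 : ℤ) < M := by exact_mod_cast hM
  unfold lineWeight
  congr 2
  symm
  refine Set.ncard_congr (fun t _ => ((N * b.1 + t * l.1) % M, (N * b.2 + t * l.2) % M)) ?_ ?_ ?_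
  · rintro t ⟨h1, h2⟩
    refine ⟨⟨Int.emod_nonneg _ hM'.ne', Int.emod_lt_of_pos _ hM'⟩,
      ⟨Int.emod_nonneg _ hM'.ne', Int.emod_lt_of_pos _ hM'⟩, ?_, hS _ _ ?_ h1⟩
    · have h3 : l.1 * (N * b.2 + t * l.2) - l.2 * (N * b.1 + t * l.1) = N := by
        linear_combination N * hlb
      conv_rhs => rw [← h3]
      exact ((Int.mod_modEq _ _).mul_left _).sub ((Int.mod_modEq _ _).mul_left _)
    · refine binProd_modEq rfl rfl ?_ ?_
      · simpa using (Int.mod_modEq _ _).symm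
      · simpa using (Int.mod_modEq _ _).symm
  · rintro t t' ⟨-, h1⟩ ⟨-, h2⟩ h
    simp only [Prod.mk.injEq] at h
    have h3 : N * b.1 + t * l.1 ≡ N * b.1 + t' * l.1 [ZMOD M] := h.1
    have h4 : N * b.2 + t * l.2 ≡ N * b.2 + t' * l.2 [ZMOD M] := h.2
    have h5 := (((h3.mul_right b.2).sub (h4.mul_right b.1)))
    have h6 : t ≡ t' [ZMOD M] := by
      convert h5 using 1
      · linear_combination (-t) * hlb
      · linear_combination (-t') * hlb
    rwa [Int.ModEq, Int.emod_eq_of_lt h1.1 h1.2, Int.emod_eq_of_lt h2.1 h2.2] at h6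
  · rintro m ⟨h1, h2, h3, h4⟩
    set t := m.1 * b.2 - m.2 * b.1 with ht
    have e1 : N * b.1 + t % M * l.1 ≡ m.1 [ZMOD M] := by
      have h5 : m.1 = (l.1 * m.2 - l.2 * m.1) * b.1 + t * l.1 := by
        rw [ht]; linear_combination (-m.1) * hlb
      conv_rhs => rw [h5]
      exact (h3.symm.mul_right _).add ((Int.mod_modEq _ _).mul_right _)
    have e2 : N * b.2 + t % M * l.2 ≡ m.2 [ZMOD M] := by
      have h5 : m.2 = (l.1 * m.2 - l.2 * m.1) * b.2 + t * l.2 := by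
        rw [ht]; linear_combination (-m.2) * hlb
      conv_rhs => rw [h5]
      exact (h3.symm.mul_right _).add ((Int.mod_modEq _ _).mul_right _)
    refine ⟨t % M, ⟨?_, Int.emod_nonneg _ hM'.ne', Int.emod_lt_of_pos _ hM'⟩, ?_⟩
    · refine hS _ _ (fun i => (binProd_modEq (l := l) (l' := l) rfl rfl ?_ ?_ i).symm) h4
      · simpa using e1
      · simpa using e2
    · rw [Int.ModEq, Int.emod_eq_of_lt h1.1 h1.2] at e1
      rw [Int.ModEq, Int.emod_eq_of_lt h2.1 h2.2] at e2
      exact Prod.ext e1 e2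

lemma finite_abs_add_lt (W : Set ℤ) (x X : ℝ) : {t : ℤ | t ∈ W ∧ |t + x| < X}.Finite := by
  refine (Set.finite_Icc ⌊-x - X⌋ ⌈-x + X⌉).subset fun t ht => ?_
  obtain ⟨-, ht⟩ := ht
  rw [abs_lt] at ht
  constructor
  · exact_mod_cast (Int.floor_le (-x - X)).trans (by linarith : -x - X ≤ t)
  · exact_mod_cast (by linarith : (t : ℝ) ≤ -x + X).trans (Int.le_ceil _)

/-- For a fixed primitive linear form `l`, the number of forms `m` with `det (l, m) = N` whose
product with `l` lies in `S` and has size less than `T`. -/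
lemma exists_line_count_bound (G : Seminorm ℝ (Fin 3 → ℝ)) (hG : ∀ v, G v = 0 → v = 0)
    (S : Set (Fin 3 → ℤ)) (N : ℤ) (M : ℕ) (hM : 0 < M)
    (hS : ∀ y y' : Fin 3 → ℤ, (∀ i, y i ≡ y' i [ZMOD M]) → y ∈ S → y' ∈ S) :
    ∃ E, ∀ l : ℤ × ℤ, IsCoprime l.1 l.2 → ∀ T : ℝ, 0 ≤ T →
      {m : ℤ × ℤ | l.1 * m.2 - l.2 * m.1 = N ∧ binProd l m ∈ S ∧
        G (fun i => ((binProd l m i : ℤ) : ℝ)) < T}.Finite ∧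
      |({m : ℤ × ℤ | l.1 * m.2 - l.2 * m.1 = N ∧ binProd l m ∈ S ∧
        G (fun i => ((binProd l m i : ℤ) : ℝ)) < T}.ncard : ℝ) - 2 * T *
          (lineWeight S N M l.1 l.2 / √(G (binProd ((l.1 : ℝ), (l.2 : ℝ)) (l.1, l.2))) ^ 2)| ≤
        E := by
  obtain ⟨κ, hκ, K, hK, hb⟩ := exists_seminorm_bounds G hG
  have hMR : (0 : ℝ) < M := by exact_mod_cast hM
  set D : ℝ := K * (3 * |(N : ℝ)|) with hD
  have hD0 : 0 ≤ D := by positivity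
  refine ⟨6 * D / κ + 2 * M, fun l hl T hT => ?_⟩
  obtain ⟨b₂, b₁, hb12⟩ := hl
  set b : ℤ × ℤ := (-b₁, b₂) with hbdef
  have hlb : l.1 * b.2 - l.2 * b.1 = 1 := by rw [hbdef]; linear_combination hb12
  set W : Set ℤ := {t : ℤ | binProd l (N • b + t • l) ∈ S} with hWdef
  have hW (t t' : ℤ) (h : t ≡ t' [ZMOD M]) (ht : t ∈ W) : t' ∈ W := by
    refine hS _ _ (binProd_modEq rfl rfl ?_ ?_) ht
    · simpa using (h.mul_right _).add_left _
    · simpa using (h.mul_right _).add_left _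
  set p : ℝ := (l.1 : ℝ) with hp
  set q : ℝ := (l.2 : ℝ) with hq
  set A : ℝ := p ^ 2 + q ^ 2 with hA
  have hlbR : p * b.2 - q * b.1 = 1 := by
    rw [hp, hq]
    exact_mod_cast congrArg (Int.cast : ℤ → ℝ) hlb
  have hA1 : 1 ≤ A := by
    have : 1 ≤ l.1 ^ 2 + l.2 ^ 2 := by
      by_contra! h
      have h1 : l.1 = 0 := by nlinarith [sq_nonneg l.1, sq_nonneg l.2]
      have h2 : l.2 = 0 := by nlinarith [sq_nonneg l.1, sq_nonneg l.2]
      rw [h1, h2] at hlb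
      simp at hlb
    rw [hA, hp, hq]
    exact_mod_cast this
  set ρ2 : ℝ := G (binProd (p, q) (p, q)) with hρ2
  have hρ2κ : κ / 3 ≤ ρ2 := by
    have h1 := sq_mul_sq_le_norm_binProd (p, q) (p, q)
    have h2 : 1 ≤ 3 * ‖binProd (p, q) (p, q)‖ := by
      refine le_of_sq_le_sq ?_ (by positivity)
      simp only [← hA] at h1
      nlinarith
    have h3 := (hb (binProd (p, q) (p, q))).1
    nlinarith
  have hρ0 : 0 < ρ2 := by linarith
  rw [Real.sq_sqrt hρ0.le]
  set u : ℝ × ℝ := (-(N * q / A), N * p / A) with hu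
  set x : ℝ := N * (b.1 * p + b.2 * q) / A with hx
  have hA0 : A ≠ 0 := by positivity
  have hdec (t : ℤ) : (fun i => ((binProd l (N • b + t • l) i : ℤ) : ℝ)) =
      binProd (p, q) u + ((t : ℝ) + x) • binProd (p, q) (p, q) := by
    rw [cast_binProd, ← binProd_smul_right, ← binProd_add_right]
    congr 1
    ext
    · simp [hu, hx]
      field_simp
      rw [hA]
      linear_combination (-(N : ℝ) * q) * hlbR
    · simp [hu, hx]
      field_simp
      rw [hA]
      linear_combination ((N : ℝ) * p) * hlbR
  have hGu : G (binProd (p, q) u) ≤ D := by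
    refine (hb _).2.trans (mul_le_mul_of_nonneg_left ?_ hK.le)
    refine (norm_binProd_le (p, q) u).trans ?_
    have e : |u.1| + |u.2| = |(N : ℝ)| / A * (|p| + |q|) := by
      rw [hu]
      simp only [abs_neg, abs_div, abs_mul, abs_of_pos (by positivity : 0 < A)]
      ring
    rw [e]
    have h1 : (|p| + |q|) ^ 2 ≤ 3 * A := by
      rw [hA]
      nlinarith [sq_nonneg (|p| - |q|), sq_abs p, sq_abs q]
    calc (|p| + |q|) * (|(N : ℝ)| / A * (|p| + |q|)) = |(N : ℝ)| / A * (|p| + |q|) ^ 2 := by ring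
      _ ≤ |(N : ℝ)| / A * (3 * A) := by gcongr
      _ = 3 * |(N : ℝ)| := by field_simp
  have hGt (t : ℤ) :
      |G (fun i => ((binProd l (N • b + t • l) i : ℤ) : ℝ)) - |(t : ℝ) + x| * ρ2| ≤ D := by
    have e : |(t : ℝ) + x| * ρ2 = G (((t : ℝ) + x) • binProd (p, q) (p, q)) := by
      rw [map_smul_eq_mul, Real.norm_eq_abs]
    rw [hdec, e]
    refine (abs_sub_map_le_sub G _ _).trans ?_
    rwa [add_sub_cancel_right]
  set Z : Set ℤ :=
    {t : ℤ | t ∈ W ∧ G (fun i => ((binProd l (N • b + t • l) i : ℤ) : ℝ)) < T} with hZ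
  have himg : {m : ℤ × ℤ | l.1 * m.2 - l.2 * m.1 = N ∧ binProd l m ∈ S ∧
      G (fun i => ((binProd l m i : ℤ) : ℝ)) < T} = (fun t : ℤ => N • b + t • l) '' Z := by
    ext m
    constructor
    · rintro ⟨h1, h2, h3⟩
      have e : N • b + (m.1 * b.2 - m.2 * b.1) • l = m := by
        ext
        · simp
          linear_combination (-b.1) * h1 + m.1 * hlb
        · simp
          linear_combination (-b.2) * h1 + m.2 * hlb
      refine ⟨m.1 * b.2 - m.2 * b.1, ⟨?_, ?_⟩, e⟩
      · rw [hWdef, Set.mem_ofPred_eq, e]; exact h2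
      · rw [e]; exact h3
    · rintro ⟨t, ⟨h1, h2⟩, rfl⟩
      refine ⟨?_, h1, h2⟩
      simp
      linear_combination N * hlb
  have hinj : Function.Injective fun t : ℤ => N • b + t • l := by
    intro t t' h
    simp only [add_right_inj, Prod.ext_iff, Prod.smul_fst, Prod.smul_snd, smul_eq_mul] at h
    linear_combination b.2 * h.1 - b.1 * h.2 - (t - t') * hlb
  have hup : Z ⊆ {t : ℤ | t ∈ W ∧ |t + x| < (T + D) / ρ2} := by
    rintro t ⟨h1, h2⟩
    refine ⟨h1, ?_⟩
    rw [lt_div_iff₀ hρ0]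
    linarith [(abs_le.mp (hGt t)).1]
  have hlo : {t : ℤ | t ∈ W ∧ |t + x| < (T - D) / ρ2} ⊆ Z := by
    rintro t ⟨h1, h2⟩
    refine ⟨h1, ?_⟩
    rw [lt_div_iff₀ hρ0] at h2
    linarith [(abs_le.mp (hGt t)).2]
  have hZfin : Z.Finite := (finite_abs_add_lt W x _).subset hup
  refine ⟨himg ▸ hZfin.image _, ?_⟩
  rw [himg, Set.ncard_image_of_injective _ hinj, lineWeight_eq S N M hM hS l b hlb]
  have c1 : (Z.ncard : ℝ) ≤ _ := (Nat.cast_le.mpr (Set.ncard_le_ncard hup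
    (finite_abs_add_lt W x _))).trans ((abs_ncard_periodic_sub_le M hM W hW x _).2
      (div_nonneg (by linarith) hρ0.le))
  have c2 : (Z.ncard : ℝ) ≥ _ := ge_trans (Nat.cast_le.mpr (Set.ncard_le_ncard hlo hZfin))
    (abs_ncard_periodic_sub_le M hM W hW x ((T - D) / ρ2)).1
  set ω : ℝ := ({t : ℤ | t ∈ W ∧ 0 ≤ t ∧ t < M}.ncard : ℝ) / M with hω
  have hω0 : 0 ≤ ω := by positivity
  have hω1 : ω ≤ 1 := by
    rw [hω, div_le_one hMR]
    have h1 : {t : ℤ | t ∈ W ∧ 0 ≤ t ∧ t < M} ⊆ (Finset.Ico (0 : ℤ) M : Set ℤ) := by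
      rintro t ⟨-, h⟩
      simpa using h
    have h2 := Set.ncard_le_ncard h1
    rw [Set.ncard_coe_finset, Int.card_Ico, sub_zero, Int.toNat_natCast] at h2
    exact_mod_cast h2
  have hDρ : D / ρ2 * ω ≤ 3 * D / κ := by
    have h1 : D / ρ2 ≤ D / (κ / 3) := by gcongr
    calc D / ρ2 * ω ≤ D / (κ / 3) * 1 := by gcongr
      _ = 3 * D / κ := by field_simp
  have e1 : 2 * ((T + D) / ρ2) * ω = 2 * T * (ω / ρ2) + 2 * (D / ρ2 * ω) := by ring
  have e2 : 2 * ((T - D) / ρ2) * ω = 2 * T * (ω / ρ2) - 2 * (D / ρ2 * ω) := by ring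
  rw [e1] at c1
  rw [e2] at c2
  have e3 : 6 * D / κ = 2 * (3 * D / κ) := by ring
  rw [e3, abs_le]
  constructor <;> linarith

lemma exists_isCoprime_smul (m : ℤ × ℤ) :
    ∃ (g : ℤ) (l : ℤ × ℤ), 0 ≤ g ∧ IsCoprime l.1 l.2 ∧ m = g • l := by
  by_cases hm : m = 0
  · exact ⟨0, (1, 0), le_rfl, isCoprime_one_left, by simp [hm]⟩
  · have h : 0 < Int.gcd m.1 m.2 := by
      rw [Nat.pos_iff_ne_zero, Ne, Int.gcd_eq_zero_iff]
      exact fun h => hm (Prod.ext h.1 h.2)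
    obtain ⟨p, q, hpq, h1, h2⟩ := Int.exists_gcd_one h
    refine ⟨Int.gcd m.1 m.2, (p, q), by positivity, Int.isCoprime_iff_gcd_eq_one.mpr hpq, ?_⟩
    ext
    · simpa [mul_comm] using h1
    · simpa [mul_comm] using h2

/-- An integral binary quadratic form of square discriminant `N ^ 2` is a product of two integral
linear forms of determinant `N`, the first of which is primitive. -/
lemma exists_binProd_eq (N : ℤ) (y : Fin 3 → ℤ)
    (hy : y 1 ^ 2 - 4 * y 0 * y 2 = N ^ 2) :
    ∃ l m : ℤ × ℤ, IsCoprime l.1 l.2 ∧ l.1 * m.2 - l.2 * m.1 = N ∧ binProd l m = y := by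
  obtain ⟨β, hβ⟩ : ∃ β, y 1 = 2 * β + N := by
    have h2 : (y 1 - N) % 2 = 0 := by
      have h3 : (y 1 - N) * (y 1 + N) = 4 * (y 0 * y 2) := by linear_combination hy
      by_contra h
      obtain ⟨k, hk⟩ : ∃ k, y 1 - N = 2 * k + 1 := ⟨(y 1 - N) / 2, by omega⟩
      have h5 : (2 * k + 1) * (2 * k + 1 + 2 * N) = 4 * (y 0 * y 2) := by
        rw [← h3, ← hk]; ring
      have h6 : 2 * (2 * k * k + 2 * k + 2 * k * N + N - 2 * (y 0 * y 2)) = -1 := by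
        linear_combination h5
      omega
    exact ⟨(y 1 - N) / 2, by omega⟩
  have hdet : y 0 * y 2 = β * (β + N) := by
    rw [hβ] at hy
    linarith
  suffices h : ∃ p q r s : ℤ, IsCoprime p q ∧ y 0 = r * p ∧ β = r * q ∧ β + N = s * p ∧
      y 2 = s * q by
    obtain ⟨p, q, r, s, hpq, h0, h1, h2, h3⟩ := h
    refine ⟨(p, q), (r, s), hpq, ?_, ?_⟩
    · simp only
      linear_combination h1 - h2
    · ext i
      fin_cases i
      · simp [binProd, h0, mul_comm]
      · simp only [binProd, Fin.mk_one, cons_val_one, cons_val_zero]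
        rw [hβ]
        linear_combination -h1 - h2
      · simp [binProd, h3, mul_comm]
  obtain ⟨r, ⟨p, q⟩, hr, ⟨u, v, huv⟩, hpq⟩ := exists_isCoprime_smul (y 0, β)
  simp only [Prod.smul_mk, smul_eq_mul, Prod.mk.injEq] at hpq
  rcases hr.eq_or_lt with rfl | hr
  · obtain ⟨s, ⟨p', q'⟩, -, hc, hpq'⟩ := exists_isCoprime_smul (β + N, y 2)
    simp only [Prod.smul_mk, smul_eq_mul, Prod.mk.injEq] at hpq'
    exact ⟨p', q', 0, s, hc, by simp [hpq.1], by simp [hpq.2], hpq'.1, hpq'.2⟩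
  · have h1 : p * y 2 = q * (β + N) := by
      have : r * (p * y 2 - q * (β + N)) = 0 := by
        rw [hpq.1] at hdet
        linear_combination hdet + (β + N) * hpq.2
      rcases mul_eq_zero.mp this with h | h <;> linarith
    simp only at huv
    refine ⟨p, q, r, u * (β + N) + v * y 2, ⟨u, v, huv⟩, hpq.1, hpq.2, ?_, ?_⟩
    · linear_combination -(β + N) * huv - v * h1
    · linear_combination -(y 2) * huv + u * h1

lemma eq_or_eq_neg_of_binProd_eq (N : ℤ) (hN : 0 < N) (l m l' m' : ℤ × ℤ)
    (hl : IsCoprime l.1 l.2) (hl' : IsCoprime l'.1 l'.2) (h : l.1 * m.2 - l.2 * m.1 = N)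
    (h' : l'.1 * m'.2 - l'.2 * m'.1 = N) (hp : binProd l' m' = binProd l m) :
    (l', m') = (l, m) ∨ (l', m') = -(l, m) := by
  obtain ⟨p, q⟩ := l
  obtain ⟨r, s⟩ := m
  obtain ⟨p', q'⟩ := l'
  obtain ⟨r', s'⟩ := m'
  have e0 := congrFun hp 0
  have e1 := congrFun hp 1
  have e2 := congrFun hp 2
  simp only [binProd, cons_val_zero, cons_val_one, cons_val] at e0 e1 e2 h h' hl hl'
  have e3 : p' * s' = p * s := by linarith
  have e4 : q' * r' = q * r := by linarith
  obtain ⟨u, v, huv⟩ := hl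
  obtain ⟨u', v', huv'⟩ := hl'
  have hpar : p * q' - q * p' = 0 := by
    have h1 : r * (p * q' - q * p') = 0 := by linear_combination -q' * e0 + p' * e4
    have h2 : s * (p * q' - q * p') = 0 := by linear_combination -q' * e3 + p' * e2
    rcases mul_eq_zero.mp h1 with hr | h3
    · rcases mul_eq_zero.mp h2 with hs | h3
      · rw [hr, hs] at h; simp at h; omega
      · exact h3
    · exact h3
  set t := u * p' + v * q' with ht
  have hp' : p' = t * p := by rw [ht]; linear_combination -p' * huv - v * hpar
  have hq' : q' = t * q := by rw [ht]; linear_combination -q' * huv + u * hpar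
  have hunit : t * (u' * p + v' * q) = 1 := by
    rw [hp', hq'] at huv'
    linear_combination huv'
  have hts : t * s' = s := by
    rw [hp'] at e3
    rw [hq'] at e2
    linear_combination -t * s' * huv + u * e3 + v * e2 + s * huv
  have htr : t * r' = r := by
    rw [hp'] at e0
    rw [hq'] at e4
    linear_combination -t * r' * huv + u * e0 + v * e4 + r * huv
  rcases Int.isUnit_iff.mp (IsUnit.of_mul_eq_one _ hunit) with h1 | h1
  · left
    rw [h1] at hp' hq' hts htr
    simp [hp', hq', ← hts, ← htr]
  · right
    rw [h1] at hp' hq' hts htr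
    simp [hp', hq', ← hts, ← htr]

/-- Factored representations of the forms in `S` of discriminant `N ^ 2` and size less than `T`. -/
def pairSet (G : Seminorm ℝ (Fin 3 → ℝ)) (S : Set (Fin 3 → ℤ)) (N : ℤ) (T : ℝ) :
    Set ((ℤ × ℤ) × (ℤ × ℤ)) :=
  {z | IsCoprime z.1.1 z.1.2 ∧ z.1.1 * z.2.2 - z.1.2 * z.2.1 = N ∧ binProd z.1 z.2 ∈ S ∧
    G (fun i => ((binProd z.1 z.2 i : ℤ) : ℝ)) < T}

lemma one_le_sq_add_sq {l : ℤ × ℤ} (hl : l ≠ 0) : 1 ≤ l.1 ^ 2 + l.2 ^ 2 := by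
  by_contra! h
  have h1 : l.1 = 0 := by nlinarith [sq_nonneg l.1, sq_nonneg l.2]
  have h2 : l.2 = 0 := by nlinarith [sq_nonneg l.1, sq_nonneg l.2]
  exact hl (Prod.ext h1 h2)

lemma ne_zero_of_mem_pairSet {G : Seminorm ℝ (Fin 3 → ℝ)} {S : Set (Fin 3 → ℤ)} {N : ℤ} {T : ℝ}
    (hN : 0 < N) {z : (ℤ × ℤ) × (ℤ × ℤ)} (hz : z ∈ pairSet G S N T) : z.1 ≠ 0 ∧ z.2 ≠ 0 := by
  have h := hz.2.1
  constructor <;> intro h0 <;> rw [h0] at h <;> simp at h <;> omega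

lemma finite_pairSet (G : Seminorm ℝ (Fin 3 → ℝ)) (hG : ∀ v, G v = 0 → v = 0)
    (S : Set (Fin 3 → ℤ)) (N : ℤ) (hN : 0 < N) (T : ℝ) : (pairSet G S N T).Finite := by
  obtain ⟨κ, hκ, K, hK, hb⟩ := exists_seminorm_bounds G hG
  set R : ℤ := ⌈9 * (T / κ) ^ 2⌉ with hR
  have hI := Set.finite_Icc ((-R, -R) : ℤ × ℤ) (R, R)
  refine (hI.prod hI).subset fun z hz => ?_
  have hz' := ne_zero_of_mem_pairSet hN hz
  have h1 := one_le_sq_add_sq hz'.1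
  have h2 := one_le_sq_add_sq hz'.2
  obtain ⟨-, -, -, hT⟩ := hz
  rw [cast_binProd] at hT
  have h3 := sq_mul_sq_le_norm_binProd ((z.1.1 : ℝ), (z.1.2 : ℝ)) ((z.2.1 : ℝ), (z.2.2 : ℝ))
  have h4 := (hb (binProd ((z.1.1 : ℝ), (z.1.2 : ℝ)) ((z.2.1 : ℝ), (z.2.2 : ℝ)))).1
  have h5 : ‖binProd ((z.1.1 : ℝ), (z.1.2 : ℝ)) ((z.2.1 : ℝ), (z.2.2 : ℝ))‖ ≤ T / κ := by
    rw [le_div_iff₀ hκ]; linarith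
  have h6 : (z.1.1 ^ 2 + z.1.2 ^ 2) * (z.2.1 ^ 2 + z.2.2 ^ 2) ≤ R := by
    have h7 : (((z.1.1 ^ 2 + z.1.2 ^ 2) * (z.2.1 ^ 2 + z.2.2 ^ 2) : ℤ) : ℝ) ≤
        9 * (T / κ) ^ 2 := by
      push_cast
      refine h3.trans ?_
      gcongr
    exact_mod_cast h7.trans (Int.le_ceil _)
  have key (a : ℤ) (ha : a ^ 2 ≤ R) : -R ≤ a ∧ a ≤ R := by
    rw [← abs_le]
    rcases eq_or_ne a 0 with rfl | h0
    · simpa using ha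
    · have : 1 ≤ |a| := Int.one_le_abs h0
      nlinarith [sq_abs a]
  have k1 := key z.1.1 (by nlinarith [sq_nonneg z.1.1, sq_nonneg z.1.2])
  have k2 := key z.1.2 (by nlinarith [sq_nonneg z.1.1, sq_nonneg z.1.2])
  have k3 := key z.2.1 (by nlinarith [sq_nonneg z.2.1, sq_nonneg z.2.2])
  have k4 := key z.2.2 (by nlinarith [sq_nonneg z.2.1, sq_nonneg z.2.2])
  exact ⟨⟨⟨k1.1, k2.1⟩, ⟨k1.2, k2.2⟩⟩, ⟨⟨k3.1, k4.1⟩, ⟨k3.2, k4.2⟩⟩⟩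

lemma ncard_pairSet (G : Seminorm ℝ (Fin 3 → ℝ)) (hG : ∀ v, G v = 0 → v = 0)
    (S : Set (Fin 3 → ℤ)) (N : ℤ) (hN : 0 < N) (T : ℝ) :
    (pairSet G S N T).ncard = 2 * {y : Fin 3 → ℤ | y ∈ S ∧ y 1 ^ 2 - 4 * y 0 * y 2 = N ^ 2 ∧
      G (fun i => (y i : ℝ)) < T}.ncard := by
  classical
  set f : (ℤ × ℤ) × (ℤ × ℤ) → (Fin 3 → ℤ) := fun z => binProd z.1 z.2 with hf
  have hfin := finite_pairSet G hG S N hN T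
  have hY : {y : Fin 3 → ℤ | y ∈ S ∧ y 1 ^ 2 - 4 * y 0 * y 2 = N ^ 2 ∧
      G (fun i => (y i : ℝ)) < T} = (hfin.toFinset.image f : Finset (Fin 3 → ℤ)) := by
    rw [Finset.coe_image, Set.Finite.coe_toFinset]
    ext y
    constructor
    · rintro ⟨h1, h2, h3⟩
      obtain ⟨l, m, hl, hlm, rfl⟩ := exists_binProd_eq N y h2
      exact ⟨(l, m), ⟨hl, hlm, h1, h3⟩, rfl⟩
    · rintro ⟨z, ⟨h1, h2, h3, h4⟩, rfl⟩
      refine ⟨h3, ?_, h4⟩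
      simp only [hf, binProd, cons_val_zero, cons_val_one, cons_val]
      rw [← h2]
      ring
  rw [hY, Set.ncard_coe_finset, Set.ncard_eq_toFinset_card _ hfin,
    Finset.card_eq_sum_card_image f, mul_comm, ← smul_eq_mul]
  refine Finset.sum_const_nat fun y hy => ?_
  obtain ⟨z, hz, rfl⟩ := Finset.mem_image.mp hy
  rw [Set.Finite.mem_toFinset] at hz
  have hneg : z ≠ -z := by
    intro h
    have h1 := congrArg (fun z => z.1.1) h
    have h2 := congrArg (fun z => z.1.2) h
    simp only [Prod.fst_neg, Prod.snd_neg] at h1 h2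
    exact (ne_zero_of_mem_pairSet hN hz).1 (Prod.ext (by simp; omega) (by simp; omega))
  have hfn : f (-z) = f z := by
    ext i; fin_cases i <;> simp [hf, binProd]
  rw [← Finset.card_pair hneg]
  congr 1
  ext z'
  simp only [Finset.mem_filter, Set.Finite.mem_toFinset, Finset.mem_insert, Finset.mem_singleton]
  constructor
  · rintro ⟨h1, h2⟩
    exact eq_or_eq_neg_of_binProd_eq N hN z.1 z.2 z'.1 z'.2 hz.1 h1.1 hz.2.1 h1.2.1 h2
  · rintro (rfl | rfl)
    · exact ⟨hz, rfl⟩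
    · refine ⟨⟨?_, ?_, ?_, ?_⟩, hfn⟩
      · exact hz.1.neg_neg
      · simpa using hz.2.1
      · change f (-z) ∈ S
        rw [hfn]; exact hz.2.2.1
      · change G (fun i => ((f (-z) i : ℤ) : ℝ)) < T
        rw [hfn]; exact hz.2.2.2

/-- The primitive integral vector of which `m` is a nonnegative multiple. -/
def primPart (m : ℤ × ℤ) : ℤ × ℤ := (m.1 / Int.gcd m.1 m.2, m.2 / Int.gcd m.1 m.2)

lemma gcd_smul_primPart (m : ℤ × ℤ) : (Int.gcd m.1 m.2 : ℤ) • primPart m = m := by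
  ext
  · exact Int.mul_ediv_cancel' (Int.gcd_dvd_left _ _)
  · exact Int.mul_ediv_cancel' (Int.gcd_dvd_right _ _)

lemma gcd_pos_of_ne_zero {m : ℤ × ℤ} (hm : m ≠ 0) : (0 : ℤ) < Int.gcd m.1 m.2 := by
  have : Int.gcd m.1 m.2 ≠ 0 := by
    rw [Ne, Int.gcd_eq_zero_iff]
    exact fun h => hm (Prod.ext h.1 h.2)
  positivity

lemma isCoprime_primPart {m : ℤ × ℤ} (hm : m ≠ 0) : IsCoprime (primPart m).1 (primPart m).2 := by
  rw [Int.isCoprime_iff_gcd_eq_one]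
  exact Int.gcd_ediv_gcd_ediv_gcd (by exact_mod_cast gcd_pos_of_ne_zero hm)

lemma gcd_smul_of_isCoprime {l : ℤ × ℤ} (hl : IsCoprime l.1 l.2) (g : ℤ) :
    (Int.gcd (g • l).1 (g • l).2 : ℤ) = |g| := by
  simp [Int.gcd_mul_left, Int.isCoprime_iff_gcd_eq_one.mp hl]

/-- The map exchanging (up to sign) the two primitive linear forms in a factored form. -/
def swapPair (z : (ℤ × ℤ) × (ℤ × ℤ)) : (ℤ × ℤ) × (ℤ × ℤ) :=
  (primPart z.2, (-(Int.gcd z.2.1 z.2.2 : ℤ)) • z.1)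

/-- The squared Euclidean norm of an integral vector. -/
def sqNorm (l : ℤ × ℤ) : ℤ := l.1 ^ 2 + l.2 ^ 2

section

variable {G : Seminorm ℝ (Fin 3 → ℝ)} {S : Set (Fin 3 → ℤ)} {N : ℤ} {T : ℝ}

lemma swapPair_mem (hS : ∀ y ∈ S, -y ∈ S) (hN : 0 < N) {z : (ℤ × ℤ) × (ℤ × ℤ)}
    (hz : z ∈ pairSet G S N T) : swapPair z ∈ pairSet G S N T := by
  have h0 := (ne_zero_of_mem_pairSet hN hz).2
  obtain ⟨h1, h2, h3, h4⟩ := hz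
  have e := gcd_smul_primPart z.2
  have e1 := congrArg Prod.fst e
  have e2 := congrArg Prod.snd e
  simp only [Prod.smul_fst, Prod.smul_snd, smul_eq_mul] at e1 e2
  have hp : binProd (swapPair z).1 (swapPair z).2 = -binProd z.1 z.2 := by
    ext i
    fin_cases i <;> simp only [swapPair, binProd, Prod.smul_fst, Prod.smul_snd, smul_eq_mul,
      Pi.neg_apply, Fin.zero_eta, Fin.mk_one, Fin.reduceFinMk, cons_val_zero, cons_val_one,
      cons_val]
    · linear_combination -z.1.1 * e1
    · linear_combination -z.1.2 * e1 - z.1.1 * e2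
    · linear_combination -z.1.2 * e2
  refine ⟨isCoprime_primPart h0, ?_, ?_, ?_⟩
  · simp only [swapPair, Prod.smul_fst, Prod.smul_snd, smul_eq_mul]
    linear_combination h2 - z.1.2 * e1 + z.1.1 * e2
  · rw [hp]; exact hS _ h3
  · have : (fun i => ((binProd (swapPair z).1 (swapPair z).2 i : ℤ) : ℝ)) =
        -fun i => ((binProd z.1 z.2 i : ℤ) : ℝ) := by
      rw [hp]; ext i; simp
    rw [this, map_neg_eq_map]
    exact h4

lemma primPart_swapPair (hN : 0 < N) {z : (ℤ × ℤ) × (ℤ × ℤ)} (hz : z ∈ pairSet G S N T) :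
    primPart (swapPair z).2 = -z.1 := by
  have hg := gcd_pos_of_ne_zero (ne_zero_of_mem_pairSet hN hz).2
  have h := gcd_smul_of_isCoprime hz.1 (-(Int.gcd z.2.1 z.2.2 : ℤ))
  rw [abs_neg, abs_of_pos hg] at h
  unfold primPart
  simp only [swapPair]
  rw [h]
  ext
  · simp only [Prod.smul_fst, smul_eq_mul, Prod.fst_neg]
    rw [neg_mul, ← mul_neg, Int.mul_ediv_cancel_left _ hg.ne']
  · simp only [Prod.smul_snd, smul_eq_mul, Prod.snd_neg]
    rw [neg_mul, ← mul_neg, Int.mul_ediv_cancel_left _ hg.ne']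

lemma swapPair_swapPair (hN : 0 < N) {z : (ℤ × ℤ) × (ℤ × ℤ)} (hz : z ∈ pairSet G S N T) :
    swapPair (swapPair z) = -z := by
  have hg := gcd_pos_of_ne_zero (ne_zero_of_mem_pairSet hN hz).2
  have h := gcd_smul_of_isCoprime hz.1 (-(Int.gcd z.2.1 z.2.2 : ℤ))
  rw [abs_neg, abs_of_pos hg] at h
  refine Prod.ext (primPart_swapPair hN hz) ?_
  change (-(Int.gcd (swapPair z).2.1 (swapPair z).2.2 : ℤ)) • primPart z.2 = -z.2
  simp only [swapPair]
  rw [h, neg_smul, gcd_smul_primPart]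

lemma sqNorm_neg (l : ℤ × ℤ) : sqNorm (-l) = sqNorm l := by simp [sqNorm]

lemma card_filter_sqNorm_le (hS : ∀ y ∈ S, -y ∈ S) (hN : 0 < N)
    (P : Finset ((ℤ × ℤ) × (ℤ × ℤ))) (hP : (P : Set _) = pairSet G S N T) :
    (P.filter fun z => sqNorm z.1 ≤ sqNorm (primPart z.2)).card =
      (P.filter fun z => sqNorm (primPart z.2) ≤ sqNorm z.1).card := by
  have hmem (z : (ℤ × ℤ) × (ℤ × ℤ)) : z ∈ P ↔ z ∈ pairSet G S N T := by
    rw [← hP, Finset.mem_coe]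
  have hinj : Set.InjOn swapPair (P : Set ((ℤ × ℤ) × (ℤ × ℤ))) := by
    intro z hz z' hz' h
    rw [hP] at hz hz'
    have := congrArg swapPair h
    rwa [swapPair_swapPair hN hz, swapPair_swapPair hN hz', neg_inj] at this
  refine le_antisymm ?_ ?_
  all_goals
    refine Finset.card_le_card_of_injOn swapPair (fun z hz => ?_)
      (hinj.mono (Finset.coe_subset.mpr (Finset.filter_subset _ _)))
    simp only [Finset.coe_filter, Set.mem_ofPred_eq, hmem] at hz ⊢
    rw [primPart_swapPair hN hz.1, sqNorm_neg]
    exact ⟨swapPair_mem hS hN hz.1, hz.2⟩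

/-- For a fixed primitive `l` there are boundedly many `m` not much longer than `l`. -/
lemma card_fiber_le (hN : 0 < N) (P : Finset ((ℤ × ℤ) × (ℤ × ℤ)))
    (hP : ∀ z ∈ P, z ∈ pairSet G S N T ∧ sqNorm (primPart z.2) ≤ sqNorm z.1) (l : ℤ × ℤ) :
    (P.filter fun z => z.1 = l).card ≤ (4 * N + 1).toNat := by
  rcases (P.filter fun z => z.1 = l).eq_empty_or_nonempty with h | ⟨z₀, hz₀⟩
  · rw [h]; simp
  have hc : (4 * N + 1).toNat = (Finset.Icc (-(2 * N)) (2 * N)).card := by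
    rw [Int.card_Icc]; congr 1; ring
  rw [hc]
  have hlen (z : (ℤ × ℤ) × (ℤ × ℤ)) (hz : z ∈ P) :
      z.2.1 ^ 2 + z.2.2 ^ 2 ≤ N ^ 2 * sqNorm z.1 := by
    obtain ⟨h1, h2⟩ := hP z hz
    have e := gcd_smul_primPart z.2
    have hg := gcd_pos_of_ne_zero (ne_zero_of_mem_pairSet hN h1).2
    set g : ℤ := (Int.gcd z.2.1 z.2.2 : ℤ)
    have e1 := congrArg Prod.fst e
    have e2 := congrArg Prod.snd e
    simp only [Prod.smul_fst, Prod.smul_snd, smul_eq_mul] at e1 e2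
    have hgN : g ≤ N := by
      refine Int.le_of_dvd hN ⟨z.1.1 * (primPart z.2).2 - z.1.2 * (primPart z.2).1, ?_⟩
      rw [← h1.2.1]
      linear_combination (-z.1.1) * e2 + z.1.2 * e1
    have h3 : z.2.1 ^ 2 + z.2.2 ^ 2 = g ^ 2 * sqNorm (primPart z.2) := by
      rw [← e1, ← e2, sqNorm]; ring
    have h4 : 0 ≤ sqNorm (primPart z.2) := by unfold sqNorm; positivity
    rw [h3]
    gcongr
  refine (Finset.card_le_card (t := (Finset.Icc (-(2 * N)) (2 * N)).image
    fun t : ℤ => (l, z₀.2 + t • l)) ?_).trans Finset.card_image_le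
  intro z hz
  rw [Finset.mem_filter] at hz hz₀
  obtain ⟨hz, rfl⟩ := hz
  obtain ⟨hz₀, hl⟩ := hz₀
  have hm := (hP z hz).1
  have hm₀ := (hP z₀ hz₀).1
  obtain ⟨u, v, huv⟩ := hm.1
  have d := hm.2.1
  have d₀ := hm₀.2.1
  rw [hl] at d₀
  set t : ℤ := u * (z.2.1 - z₀.2.1) + v * (z.2.2 - z₀.2.2) with ht
  have e1 : z.2.1 = z₀.2.1 + t * z.1.1 := by
    rw [ht]; linear_combination (-(z.2.1 - z₀.2.1)) * huv - v * (d - d₀)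
  have e2 : z.2.2 = z₀.2.2 + t * z.1.2 := by
    rw [ht]; linear_combination (-(z.2.2 - z₀.2.2)) * huv + u * (d - d₀)
  refine Finset.mem_image.mpr ⟨t, ?_, ?_⟩
  · rw [Finset.mem_Icc, ← abs_le]
    refine abs_le_of_sq_le_sq ?_ (by linarith)
    have b1 := hlen z hz
    have b2 := hlen z₀ hz₀
    rw [hl] at b2
    have hq : 1 ≤ sqNorm z.1 := one_le_sq_add_sq (ne_zero_of_mem_pairSet hN hm).1
    have b3 : t ^ 2 * sqNorm z.1 ≤ (2 * N) ^ 2 * sqNorm z.1 := by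
      have : t ^ 2 * sqNorm z.1 = (z.2.1 - z₀.2.1) ^ 2 + (z.2.2 - z₀.2.2) ^ 2 := by
        rw [e1, e2, sqNorm]; ring
      rw [this]
      nlinarith [sq_nonneg (z.2.1 + z₀.2.1), sq_nonneg (z.2.2 + z₀.2.2)]
    exact le_of_mul_le_mul_right b3 (by linarith)
  · ext
    · rfl
    · rfl
    · simp [e1]
    · simp [e2]

end

lemma lineWeight_pos (S : Set (Fin 3 → ℤ)) (N : ℤ) (M : ℕ) (hM : 0 < M)
    (hS : ∀ y y' : Fin 3 → ℤ, (∀ i, y i ≡ y' i [ZMOD M]) → y ∈ S → y' ∈ S) (l m : ℤ × ℤ)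
    (hlm : l.1 * m.2 - l.2 * m.1 = N) (hmem : binProd l m ∈ S) : 0 < lineWeight S N M l.1 l.2 := by
  have hM' : (0 : ℤ) < M := by exact_mod_cast hM
  have hMR : (0 : ℝ) < M := by exact_mod_cast hM
  refine div_pos (Nat.cast_pos.mpr ((Set.ncard_pos ?_).mpr ⟨(m.1 % M, m.2 % M), ?_⟩)) hMR
  · refine (Set.finite_Icc ((0, 0) : ℤ × ℤ) (M, M)).subset ?_
    rintro z ⟨h1, h2, -⟩
    exact ⟨⟨h1.1, h2.1⟩, ⟨h1.2.le, h2.2.le⟩⟩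
  · refine ⟨⟨Int.emod_nonneg _ hM'.ne', Int.emod_lt_of_pos _ hM'⟩,
      ⟨Int.emod_nonneg _ hM'.ne', Int.emod_lt_of_pos _ hM'⟩, ?_, hS _ _ ?_ hmem⟩
    · conv_rhs => rw [← hlm]
      exact ((Int.mod_modEq _ _).mul_left _).sub ((Int.mod_modEq _ _).mul_left _)
    · exact binProd_modEq rfl rfl (Int.mod_modEq _ _).symm (Int.mod_modEq _ _).symm

lemma exists_pairSet_bound (G : Seminorm ℝ (Fin 3 → ℝ)) (hG : ∀ v, G v = 0 → v = 0)
    (S : Set (Fin 3 → ℤ)) (N : ℤ) :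
    ∃ C > 0, ∀ T : ℝ, ∀ z ∈ pairSet G S N T, sqNorm z.1 ≤ sqNorm (primPart z.2) → z.2 ≠ 0 →
      √(G (binProd ((z.1.1 : ℝ), (z.1.2 : ℝ)) (z.1.1, z.1.2))) ≤ √(C * T) := by
  obtain ⟨κ, hκ, K, hK, hb⟩ := exists_seminorm_bounds G hG
  refine ⟨6 * K / κ, by positivity, fun T z hz hle h0 => Real.sqrt_le_sqrt ?_⟩
  obtain ⟨-, -, -, hT⟩ := hz
  rw [cast_binProd] at hT
  have h3 := sq_mul_sq_le_norm_binProd ((z.1.1 : ℝ), (z.1.2 : ℝ)) ((z.2.1 : ℝ), (z.2.2 : ℝ))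
  have h4 := (hb (binProd ((z.1.1 : ℝ), (z.1.2 : ℝ)) ((z.2.1 : ℝ), (z.2.2 : ℝ)))).1
  set n := ‖binProd ((z.1.1 : ℝ), (z.1.2 : ℝ)) ((z.2.1 : ℝ), (z.2.2 : ℝ))‖
  have hle' : sqNorm z.1 ≤ sqNorm z.2 := by
    refine hle.trans ?_
    have hg := gcd_pos_of_ne_zero h0
    have e := gcd_smul_primPart z.2
    set g : ℤ := (Int.gcd z.2.1 z.2.2 : ℤ)
    have h5 : sqNorm z.2 = g ^ 2 * sqNorm (primPart z.2) := by
      conv_lhs => rw [← e]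
      simp only [sqNorm, Prod.smul_fst, Prod.smul_snd, smul_eq_mul]
      ring
    have h6 : 0 ≤ sqNorm (primPart z.2) := by unfold sqNorm; positivity
    rw [h5]
    exact le_mul_of_one_le_left h6 (one_le_pow₀ hg)
  set p : ℝ := (z.1.1 : ℝ) with hp
  set q : ℝ := (z.1.2 : ℝ) with hq
  have h7 : p ^ 2 + q ^ 2 ≤ (z.2.1 : ℝ) ^ 2 + (z.2.2 : ℝ) ^ 2 := by
    rw [hp, hq]
    unfold sqNorm at hle'
    exact_mod_cast hle'
  have h8 : p ^ 2 + q ^ 2 ≤ 3 * n := by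
    refine le_of_sq_le_sq ?_ (by positivity)
    nlinarith [sq_nonneg p, sq_nonneg q]
  have h9 := (hb (binProd (p, q) (p, q))).2
  have h10 := norm_binProd_le (p, q) (p, q)
  have h11 : (|p| + |q|) * (|p| + |q|) ≤ 2 * (p ^ 2 + q ^ 2) := by
    nlinarith [sq_nonneg (|p| - |q|), sq_abs p, sq_abs q]
  have h12 : n ≤ T / κ := by rw [le_div_iff₀ hκ]; linarith
  calc G (binProd (p, q) (p, q)) ≤ K * (6 * (T / κ)) :=
        h9.trans (mul_le_mul_of_nonneg_left (by simp only at h10; linarith) hK.le)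
    _ = 6 * K / κ * T := by ring

/-- Counting, in the hyperbola method fashion, factored forms by their smaller primitive factor. -/
lemma abs_ncard_pairSet_sub_le (G : Seminorm ℝ (Fin 3 → ℝ)) (S : Set (Fin 3 → ℤ))
    (hS : ∀ y ∈ S, -y ∈ S) (N : ℤ) (hN : 0 < N) (T : ℝ) (hfin : (pairSet G S N T).Finite)
    (L : Finset (ℤ × ℤ)) (hL : ∀ z ∈ pairSet G S N T, sqNorm z.1 ≤ sqNorm (primPart z.2) → z.1 ∈ L)
    (hLc : ∀ l ∈ L, IsCoprime l.1 l.2) :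
    |((pairSet G S N T).ncard : ℝ) - 2 * ∑ l ∈ L, ({m : ℤ × ℤ | l.1 * m.2 - l.2 * m.1 = N ∧
      binProd l m ∈ S ∧ G (fun i => ((binProd l m i : ℤ) : ℝ)) < T}.ncard : ℝ)| ≤
        2 * ((4 * N + 1) * L.card) := by
  classical
  set P := hfin.toFinset with hP
  have hmem (z : (ℤ × ℤ) × (ℤ × ℤ)) : z ∈ P ↔ z ∈ pairSet G S N T := hfin.mem_toFinset
  set Ps := P.filter fun z => z.1 ∈ L with hPs
  have hsum : Ps.card = ∑ l ∈ L, {m : ℤ × ℤ | l.1 * m.2 - l.2 * m.1 = N ∧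
      binProd l m ∈ S ∧ G (fun i => ((binProd l m i : ℤ) : ℝ)) < T}.ncard := by
    have hmaps : Set.MapsTo Prod.fst (Ps : Set ((ℤ × ℤ) × (ℤ × ℤ))) L :=
      fun z hz => (Finset.mem_filter.mp hz).2
    rw [Finset.card_eq_sum_card_fiberwise hmaps]
    refine Finset.sum_congr rfl fun l hl => ?_
    rw [← Set.ncard_coe_finset]
    refine Eq.trans ?_ (Set.ncard_image_of_injective _ (Prod.mk_right_injective l))
    congr 1
    ext z
    simp only [hPs, Finset.coe_filter, Finset.mem_filter, hmem, Set.mem_ofPred_eq, Set.mem_image]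
    constructor
    · rintro ⟨⟨h1, h2⟩, rfl⟩
      exact ⟨z.2, ⟨h1.2.1, h1.2.2.1, h1.2.2.2⟩, rfl⟩
    · rintro ⟨m, ⟨h1, h2, h3⟩, rfl⟩
      exact ⟨⟨⟨hLc l hl, h1, h2, h3⟩, hl⟩, rfl⟩
  have hle := card_filter_sqNorm_le hS hN P hfin.coe_toFinset
  have hsplit := P.card_filter_add_card_filter_not
    (fun z => sqNorm (primPart z.2) ≤ sqNorm z.1)
  have h1 : (P.filter fun z => sqNorm z.1 ≤ sqNorm (primPart z.2)).card ≤ Ps.card := by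
    refine Finset.card_le_card fun z hz => ?_
    rw [Finset.mem_filter] at hz
    exact Finset.mem_filter.mpr ⟨hz.1, hL z ((hmem z).mp hz.1) hz.2⟩
  have h2 : (P.filter fun z => ¬ sqNorm (primPart z.2) ≤ sqNorm z.1).card ≤
      (P.filter fun z => sqNorm z.1 ≤ sqNorm (primPart z.2)).card := by
    refine Finset.card_le_card (Finset.monotone_filter_right _ fun z _ hz => ?_)
    exact (not_le.mp hz).le
  set Q := Ps.filter fun z => sqNorm (primPart z.2) ≤ sqNorm z.1 with hQ
  have h3 : Ps.card ≤ Q.card +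
      (P.filter fun z => ¬ sqNorm (primPart z.2) ≤ sqNorm z.1).card := by
    rw [← Ps.card_filter_add_card_filter_not (fun z => sqNorm (primPart z.2) ≤ sqNorm z.1)]
    gcongr
    exact Finset.filter_subset _ _
  have h4 : Q.card ≤ L.card * (4 * N + 1).toNat := by
    have hmaps : Set.MapsTo Prod.fst (Q : Set ((ℤ × ℤ) × (ℤ × ℤ))) L :=
      fun z hz => (Finset.mem_filter.mp (Finset.mem_filter.mp hz).1).2
    rw [Finset.card_eq_sum_card_fiberwise hmaps, ← smul_eq_mul]
    refine Finset.sum_le_card_nsmul _ _ _ fun l _ =>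
      card_fiber_le (G := G) (S := S) (T := T) hN Q (fun z hz => ?_) l
    rw [hQ, Finset.mem_filter, hPs, Finset.mem_filter, hmem] at hz
    exact ⟨hz.1.1, hz.2⟩
  rw [Set.ncard_eq_toFinset_card _ hfin, ← Nat.cast_sum, ← hsum]
  have h5 : (((4 * N + 1).toNat : ℕ) : ℝ) = 4 * N + 1 := by
    have : (((4 * N + 1).toNat : ℕ) : ℤ) = 4 * N + 1 := Int.toNat_of_nonneg (by linarith)
    exact_mod_cast congrArg (Int.cast : ℤ → ℝ) this
  have h6 : P.card ≤ 2 * Ps.card := by omega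
  have h7 : 2 * Ps.card ≤ P.card + 2 * Q.card := by omega
  have h6' : (P.card : ℝ) ≤ 2 * Ps.card := by exact_mod_cast h6
  have h7' : 2 * (Ps.card : ℝ) ≤ P.card + 2 * Q.card := by exact_mod_cast h7
  have h4' : (Q.card : ℝ) ≤ L.card * (4 * N + 1) := by rw [← h5]; exact_mod_cast h4
  rw [abs_le]
  have h8 : (0 : ℝ) ≤ Q.card := by positivity
  constructor <;> nlinarith

/-- Asymptotics for the number of integral binary quadratic forms of discriminant `N ^ 2` in a
periodic set, counted with respect to a norm. -/
lemma exists_tendsto_disc_count (G : Seminorm ℝ (Fin 3 → ℝ)) (hG : ∀ v, G v = 0 → v = 0)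
    (S : Set (Fin 3 → ℤ)) (N : ℤ) (hN : 0 < N) (M : ℕ) (hM : 0 < M)
    (hS : ∀ y y' : Fin 3 → ℤ, (∀ i, y i ≡ y' i [ZMOD M]) → y ∈ S → y' ∈ S)
    (hSneg : ∀ y ∈ S, -y ∈ S) (hne : ∃ y ∈ S, y 1 ^ 2 - 4 * y 0 * y 2 = N ^ 2) :
    ∃ C > (0 : ℝ), Tendsto (fun T : ℝ => ({y : Fin 3 → ℤ | y ∈ S ∧
      y 1 ^ 2 - 4 * y 0 * y 2 = N ^ 2 ∧ G (fun i => (y i : ℝ)) < T}.ncard : ℝ) /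
        (T * Real.log T)) atTop (𝓝 C) := by
  have hρ := planeGauge_sqrt G hG
  set ρ : ℝ → ℝ → ℝ := fun x y => √(G (binProd (x, y) (x, y))) with hρdef
  have hfinL (r : ℝ) : {l : ℤ × ℤ | IsCoprime l.1 l.2 ∧ ρ l.1 l.2 ≤ r}.Finite :=
    (hρ.finite_le r).subset fun l hl => hl.2
  set L : ℝ → Finset (ℤ × ℤ) := fun r => (hfinL r).toFinset with hLdef
  have hL (r : ℝ) (l : ℤ × ℤ) : l ∈ L r ↔ IsCoprime l.1 l.2 ∧ ρ l.1 l.2 ≤ r :=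
    (hfinL r).mem_toFinset
  obtain ⟨c, hc, hlim⟩ := hρ.tendsto_sum_div_sq_div_log M hM (lineWeight S N M)
    (lineWeight_nonneg S N M) (fun a b a' b' => lineWeight_congr S N M hS a b a' b') (by
      obtain ⟨y, hy, hyN⟩ := hne
      obtain ⟨l, m, hl, hlm, rfl⟩ := exists_binProd_eq N y hyN
      exact ⟨l, hl, lineWeight_pos S N M hM hS l m hlm hy⟩) L hL
  obtain ⟨C₀, hC₀, hbound⟩ := exists_pairSet_bound G hG S N
  obtain ⟨E, hE⟩ := exists_line_count_bound G hG S N M hM hS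
  obtain ⟨C₁, hC₁, hcard⟩ := hρ.ncard_ne_zero_le
  set r : ℝ → ℝ := fun T => √(C₀ * T) with hr
  set F : ℝ → ℝ := fun T => ∑ l ∈ L (r T), lineWeight S N M l.1 l.2 / ρ l.1 l.2 ^ 2 with hF
  have hcardL (T : ℝ) (hT : 0 ≤ T) : ((L (r T)).card : ℝ) ≤ C₁ * C₀ * T := by
    have h1 : ((L (r T)).card : ℝ) ≤ {l : ℤ × ℤ | l ≠ 0 ∧ ρ l.1 l.2 ≤ r T}.ncard := by
      rw [← Set.ncard_coe_finset]
      refine Nat.cast_le.mpr (Set.ncard_le_ncard (fun l hl => ?_)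
        ((hρ.finite_le _).subset fun l hl => hl.2))
      rw [Finset.mem_coe, hL] at hl
      refine ⟨?_, hl.2⟩
      rintro rfl
      exact not_isCoprime_zero_zero hl.1
    refine (h1.trans (hcard (r T))).trans_eq ?_
    rw [hr, Real.sq_sqrt (by positivity)]
    ring
  have hmain (T : ℝ) (hT : 0 ≤ T) : |({y : Fin 3 → ℤ | y ∈ S ∧
      y 1 ^ 2 - 4 * y 0 * y 2 = N ^ 2 ∧ G (fun i => (y i : ℝ)) < T}.ncard : ℝ) - 2 * T * F T| ≤
        (4 * N + 1 + E) * (C₁ * C₀) * T := by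
    have h1 := abs_ncard_pairSet_sub_le G S hSneg N hN T (finite_pairSet G hG S N hN T) (L (r T))
      (fun z hz hle => (hL _ _).mpr ⟨hz.1, hbound T z hz hle (ne_zero_of_mem_pairSet hN hz).2⟩)
      (fun l hl => ((hL _ _).mp hl).1)
    rw [ncard_pairSet G hG S N hN T] at h1
    push_cast at h1
    set n : ℤ × ℤ → ℝ := fun l => ({m : ℤ × ℤ | l.1 * m.2 - l.2 * m.1 = N ∧
      binProd l m ∈ S ∧ G (fun i => ((binProd l m i : ℤ) : ℝ)) < T}.ncard : ℝ) with hn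
    have h2 : |∑ l ∈ L (r T), n l - 2 * T * F T| ≤ (L (r T)).card * E := by
      rw [hF, Finset.mul_sum, ← Finset.sum_sub_distrib, ← nsmul_eq_mul]
      refine (Finset.abs_sum_le_sum_abs _ _).trans (Finset.sum_le_card_nsmul _ _ _ fun l hl => ?_)
      exact (hE l ((hL _ _).mp hl).1 T hT).2
    have hE0 : 0 ≤ E :=
      (abs_nonneg _).trans (hE (1, 0) isCoprime_one_left 0 le_rfl).2
    have h3 := hcardL T hT
    have hN' : (0 : ℝ) < N := by exact_mod_cast hN
    have h4 : (4 * N + 1 + E) * (L (r T)).card ≤ (4 * N + 1 + E) * (C₁ * C₀ * T) := by gcongr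
    rw [abs_le] at h1 h2 ⊢
    constructor <;> linarith [h1.1, h1.2, h2.1, h2.2]
  have hlog := Real.tendsto_log_atTop
  have hrlim : Tendsto r atTop atTop :=
    Real.tendsto_sqrt_atTop.comp (tendsto_id.const_mul_atTop hC₀)
  have hlogr : Tendsto (fun T => Real.log (r T) / Real.log T) atTop (𝓝 (1 / 2)) := by
    have h1 : Tendsto (fun T => Real.log C₀ / 2 / Real.log T + 1 / 2) atTop (𝓝 (0 + 1 / 2)) :=
      (hlog.const_div_atTop _).add_const _
    rw [zero_add] at h1
    refine h1.congr' ?_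
    filter_upwards [eventually_gt_atTop 1] with T hT
    have hlT := Real.log_pos hT
    rw [hr, Real.log_sqrt (by positivity), Real.log_mul hC₀.ne' (by positivity)]
    field_simp
  have hFlim : Tendsto (fun T => 2 * (F T / Real.log (r T) * (Real.log (r T) / Real.log T)))
      atTop (𝓝 (2 * (c * (1 / 2)))) := ((hlim.comp hrlim).mul hlogr).const_mul 2
  refine ⟨c, hc, ?_⟩
  have herr : Tendsto (fun T : ℝ => ({y : Fin 3 → ℤ | y ∈ S ∧
      y 1 ^ 2 - 4 * y 0 * y 2 = N ^ 2 ∧ G (fun i => (y i : ℝ)) < T}.ncard : ℝ) /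
        (T * Real.log T) - 2 * (F T / Real.log (r T) * (Real.log (r T) / Real.log T)))
      atTop (𝓝 0) := by
    refine squeeze_zero_norm' ?_ (hlog.const_div_atTop ((4 * N + 1 + E) * (C₁ * C₀)))
    filter_upwards [eventually_gt_atTop 1, hrlim.eventually_gt_atTop 1] with T hT hrT
    have hlT := Real.log_pos hT
    have hlr := Real.log_pos hrT
    have hT0 : 0 < T := by linarith
    have e : 2 * (F T / Real.log (r T) * (Real.log (r T) / Real.log T)) =
        2 * T * F T / (T * Real.log T) := by field_simp
    rw [e, ← sub_div, Real.norm_eq_abs, abs_div, abs_of_pos (mul_pos hT0 hlT), div_le_div_iff₀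
      (mul_pos hT0 hlT) hlT]
    have := mul_le_mul_of_nonneg_right (hmain T hT0.le) hlT.le
    linarith
  have := herr.add hFlim
  simp only [sub_add_cancel] at this
  convert this using 2
  ring

/-- The Gram matrix of the symmetric bilinear form with `B (x, x) = 2 * QZ c x`. -/
def gramInt (c : Fin 3 → Fin 3 → ℤ) : Matrix (Fin 3) (Fin 3) ℤ := Matrix.of fun i j => c i j + c j i

lemma transpose_gramInt (c : Fin 3 → Fin 3 → ℤ) : (gramInt c)ᵀ = gramInt c := by
  ext i j; simp [gramInt, add_comm]

lemma dotProduct_gramInt_self (c : Fin 3 → Fin 3 → ℤ) (x : Fin 3 → ℤ) :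
    x ⬝ᵥ gramInt c *ᵥ x = 2 * QZ c x := by
  simp only [dotProduct, mulVec, gramInt, of_apply, QZ, Fin.sum_univ_three]
  ring

lemma dotProduct_gramInt_real (c : Fin 3 → Fin 3 → ℤ) (x y : Fin 3 → ℝ) :
    x ⬝ᵥ (gramInt c).map (Int.cast : ℤ → ℝ) *ᵥ y = QR c (x + y) - QR c x - QR c y := by
  simp only [dotProduct, mulVec, gramInt, map_apply, of_apply, QR, Fin.sum_univ_three, Pi.add_apply]
  push_cast
  ring

lemma dotProduct_gramInt_real_self (c : Fin 3 → Fin 3 → ℤ) (x : Fin 3 → ℝ) :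
    x ⬝ᵥ (gramInt c).map (Int.cast : ℤ → ℝ) *ᵥ x = 2 * QR c x := by
  simp only [dotProduct, mulVec, gramInt, map_apply, of_apply, QR, Fin.sum_univ_three]
  push_cast
  ring

lemma det_gramInt_neg (c : Fin 3 → Fin 3 → ℤ)
    (hsig : ∃ e : (Fin 3 → ℝ) ≃ₗ[ℝ] (Fin 3 → ℝ),
      ∀ v, QR c (e v) = (v 0) ^ 2 + (v 1) ^ 2 - (v 2) ^ 2) : (gramInt c).det < 0 := by
  obtain ⟨e, he⟩ := hsig
  set A := (gramInt c).map (Int.cast : ℤ → ℝ) with hA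
  set E : Matrix (Fin 3) (Fin 3) ℝ := Matrix.of fun i => e (Pi.single i 1) with hE
  have h1 : E * A * Eᵀ = diagonal ![2, 2, -2] := by
    ext i j
    have h : (E * A * Eᵀ) i j = e (Pi.single i 1) ⬝ᵥ A *ᵥ e (Pi.single j 1) := by
      rw [dotProduct_mulVec]
      rfl
    rw [h, hA, dotProduct_gramInt_real, ← map_add, he, he, he]
    fin_cases i <;> fin_cases j <;> simp <;> norm_num
  have h2 := congrArg det h1
  rw [det_mul, det_mul, det_transpose, det_diagonal, Fin.prod_univ_three] at h2
  simp only [cons_val_zero, cons_val_one, cons_val] at h2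
  have h3 : A.det = ((gramInt c).det : ℝ) := by
    rw [hA]; exact ((Int.castRingHom ℝ).map_det (gramInt c)).symm
  rw [h3] at h2
  have h4 : ((gramInt c).det : ℝ) < 0 := by nlinarith [sq_nonneg E.det]
  exact_mod_cast h4

/-- The matrix of `x ↦ x ×₃ w`, acting on row vectors. -/
def crossMatrix (w : Fin 3 → ℤ) : Matrix (Fin 3) (Fin 3) ℤ :=
  !![0, -w 2, w 1; w 2, 0, -w 0; -w 1, w 0, 0]

lemma crossMatrix_mul_five (A : Matrix (Fin 3) (Fin 3) ℤ) (hA : Aᵀ = A) (w : Fin 3 → ℤ) :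
    crossMatrix w * A * crossMatrix w * A * crossMatrix w =
      -(w ⬝ᵥ A.adjugate *ᵥ w) • crossMatrix w := by
  have h10 : A 1 0 = A 0 1 := congrFun (congrFun hA 0) 1
  have h20 : A 2 0 = A 0 2 := congrFun (congrFun hA 0) 2
  have h21 : A 2 1 = A 1 2 := congrFun (congrFun hA 1) 2
  ext i j
  simp only [mul_apply, Fin.sum_univ_three, Matrix.smul_apply, smul_eq_mul, dotProduct, mulVec,
    adjugate_fin_three]
  fin_cases i <;> fin_cases j <;> simp [crossMatrix, h10, h20, h21] <;> ring

lemma trace_mul_crossMatrix_sq (A : Matrix (Fin 3) (Fin 3) ℤ) (hA : Aᵀ = A) (w : Fin 3 → ℤ) :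
    (A * crossMatrix w * (A * crossMatrix w)).trace = -2 * (w ⬝ᵥ A.adjugate *ᵥ w) := by
  have h10 : A 1 0 = A 0 1 := congrFun (congrFun hA 0) 1
  have h20 : A 2 0 = A 0 2 := congrFun (congrFun hA 0) 2
  have h21 : A 2 1 = A 1 2 := congrFun (congrFun hA 1) 2
  simp only [trace, diag_apply, mul_apply, Fin.sum_univ_three, dotProduct, mulVec,
    adjugate_fin_three]
  simp [crossMatrix, h10, h20, h21]
  ring

lemma trace_mul_crossMatrix (A : Matrix (Fin 3) (Fin 3) ℤ) (hA : Aᵀ = A) (w : Fin 3 → ℤ) :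
    (A * crossMatrix w).trace = 0 := by
  have h10 : A 1 0 = A 0 1 := congrFun (congrFun hA 0) 1
  have h20 : A 2 0 = A 0 2 := congrFun (congrFun hA 0) 2
  have h21 : A 2 1 = A 1 2 := congrFun (congrFun hA 1) 2
  simp only [trace, diag_apply, mul_apply, Fin.sum_univ_three]
  simp [crossMatrix, h10, h20, h21]
  ring

lemma transpose_crossMatrix (w : Fin 3 → ℤ) : (crossMatrix w)ᵀ = -crossMatrix w := by
  ext i j
  fin_cases i <;> fin_cases j <;> simp [crossMatrix]

lemma vecMul_crossMatrix_self (w : Fin 3 → ℤ) : w ᵥ* crossMatrix w = 0 := by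
  ext i
  fin_cases i <;> simp [crossMatrix, vecMul, dotProduct, Fin.sum_univ_three] <;> ring

/-- If the stabilizer of `v₀` is finite, then the discriminant of the orthogonal complement of
`v₀` is, up to sign, a perfect square. -/
lemma isSquare_of_finite_stabilizer (c : Fin 3 → Fin 3 → ℤ) (hdet : (gramInt c).det < 0)
    (v₀ : Fin 3 → ℤ) (hv₀ : 0 < QZ c v₀)
    (hstab : Set.Finite {g : Matrix (Fin 3) (Fin 3) ℤ |
      g.det = 1 ∧
      (∀ x : Fin 3 → ℝ, QR c (Matrix.vecMul x (g.map (Int.cast : ℤ → ℝ))) = QR c x) ∧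
      Matrix.vecMul v₀ g = v₀}) :
    IsSquare (-(gramInt c).det * (2 * QZ c v₀)) := by
  by_contra hsq
  set A := gramInt c with hA
  have hAt : Aᵀ = A := transpose_gramInt c
  set δ : ℤ := -A.det * (2 * QZ c v₀) with hδ
  have hδ0 : 0 < δ := by rw [hδ]; exact mul_pos (by linarith) (by linarith)
  set w : Fin 3 → ℤ := v₀ ᵥ* A with hw
  have hwδ : w ⬝ᵥ A.adjugate *ᵥ w = -δ := by
    rw [hw, dotProduct_mulVec, vecMul_vecMul, mul_adjugate, vecMul_smul, vecMul_one,
      smul_dotProduct, ← mulVec_transpose, hAt, dotProduct_gramInt_self, hδ, smul_eq_mul]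
    ring
  set T := A * crossMatrix w with hT
  have hT3 : T * T * T = δ • T := by
    have h := congrArg (A * ·) (crossMatrix_mul_five A hAt w)
    simp only [hwδ, neg_neg, Matrix.mul_smul] at h
    rw [← hT] at h
    rw [← h, hT]
    simp only [Matrix.mul_assoc]
  have hTA : A * Tᵀ = -(T * A) := by
    rw [hT, transpose_mul, hAt, transpose_crossMatrix]
    simp [Matrix.mul_assoc]
  have hvT : v₀ ᵥ* T = 0 := by
    rw [hT, ← vecMul_vecMul, ← hw, vecMul_crossMatrix_self]
  have htr : T.trace = 0 := trace_mul_crossMatrix A hAt w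
  have htr2 : (T * T).trace = 2 * δ := by
    rw [hT, trace_mul_crossMatrix_sq A hAt w, hwδ]; ring
  set h : ℤ → ℤ → Matrix (Fin 3) (Fin 3) ℤ :=
    fun a b => 1 + (2 * a * b) • T + (2 * b ^ 2) • (T * T) with hh
  have hhA (a b : ℤ) (hab : a ^ 2 - δ * b ^ 2 = 1) : h a b * A * (h a b)ᵀ = A := by
    have e1 : A * (h a b)ᵀ = (1 - (2 * a * b) • T + (2 * b ^ 2) • (T * T)) * A := by
      have e2 : A * (T * T)ᵀ = T * T * A := by
        rw [transpose_mul, ← Matrix.mul_assoc, hTA, Matrix.neg_mul, Matrix.mul_assoc, hTA]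
        simp [Matrix.mul_assoc]
      simp only [hh, transpose_add, transpose_one, transpose_smul, Matrix.mul_add, Matrix.mul_one,
        Matrix.mul_smul, hTA, e2, Matrix.add_mul, Matrix.sub_mul, Matrix.smul_mul, Matrix.one_mul]
      simp [sub_eq_add_neg]
    have e3 : h a b * (1 - (2 * a * b) • T + (2 * b ^ 2) • (T * T)) = 1 := by
      have e4 : T * T * (T * T) = δ • (T * T) := by
        rw [← Matrix.mul_assoc, hT3, Matrix.smul_mul]
      have e5 : T * (T * T) = T * T * T := (Matrix.mul_assoc _ _ _).symm
      simp only [hh, Matrix.add_mul, Matrix.mul_add, Matrix.mul_sub, Matrix.mul_one,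
        Matrix.one_mul, Matrix.smul_mul, Matrix.mul_smul, e4, e5, hT3, smul_smul, smul_add]
      ext i j
      simp only [Matrix.add_apply, Matrix.sub_apply, Matrix.smul_apply, smul_eq_mul]
      linear_combination (-4 * b ^ 2 * (T * T) i j) * hab
    rw [Matrix.mul_assoc, e1, ← Matrix.mul_assoc, e3, Matrix.one_mul]
  have hhv (a b : ℤ) : v₀ ᵥ* h a b = v₀ := by
    simp only [hh, vecMul_add, vecMul_one, vecMul_smul, ← vecMul_vecMul, hvT, zero_vecMul,
      smul_zero, add_zero]
  have hmem (a b : ℤ) (hab : a ^ 2 - δ * b ^ 2 = 1) : h a b * h a b ∈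
      {g : Matrix (Fin 3) (Fin 3) ℤ | g.det = 1 ∧
      (∀ x : Fin 3 → ℝ, QR c (Matrix.vecMul x (g.map (Int.cast : ℤ → ℝ))) = QR c x) ∧
      Matrix.vecMul v₀ g = v₀} := by
    have e := hhA a b hab
    set g := h a b
    refine ⟨?_, fun x => ?_, ?_⟩
    · have h1 := congrArg det e
      rw [det_mul, det_mul, det_transpose] at h1
      rw [det_mul]
      have h2 : A.det ≠ 0 := hdet.ne
      exact mul_left_cancel₀ h2 (by linear_combination h1)
    · have e2 : g * g * A * (g * g)ᵀ = A := by
        rw [transpose_mul]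
        calc g * g * A * (gᵀ * gᵀ) = g * (g * A * gᵀ) * gᵀ := by simp only [Matrix.mul_assoc]
          _ = A := by rw [e, e]
      have e3 := congrArg (fun X => X.map (Int.cast : ℤ → ℝ)) e2
      have hm (X Y : Matrix (Fin 3) (Fin 3) ℤ) : (X * Y).map (Int.cast : ℤ → ℝ) =
          X.map Int.cast * Y.map Int.cast := Matrix.map_mul (f := Int.castRingHom ℝ)
      rw [hm (g * g * A), hm (g * g) A, transpose_map] at e3
      have e4 := dotProduct_gramInt_real_self c (x ᵥ* (g * g).map (Int.cast : ℤ → ℝ))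
      have e5 := dotProduct_gramInt_real_self c x
      rw [← hA] at e4 e5
      have e6 : (x ᵥ* (g * g).map (Int.cast : ℤ → ℝ)) ⬝ᵥ A.map (Int.cast : ℤ → ℝ) *ᵥ
          (x ᵥ* (g * g).map (Int.cast : ℤ → ℝ)) = x ⬝ᵥ A.map (Int.cast : ℤ → ℝ) *ᵥ x := by
        conv_rhs => rw [← e3]
        rw [← mulVec_transpose ((g * g).map (Int.cast : ℤ → ℝ)), mulVec_transpose,
          ← mulVec_mulVec, ← mulVec_mulVec, dotProduct_mulVec x, mulVec_transpose]
      linarith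
    · rw [← vecMul_vecMul, hhv, hhv]
  obtain ⟨s, hs⟩ := Pell.IsFundamental.exists_of_not_isSquare hδ0 hsq
  have hprop (n : ℕ) : (s ^ (n : ℤ)).x ^ 2 - δ * (s ^ (n : ℤ)).y ^ 2 = 1 := (s ^ (n : ℤ)).prop
  refine (Set.infinite_of_injective_forall_mem (f := fun n : ℕ =>
    h (s ^ (n : ℤ)).x (s ^ (n : ℤ)).y * h (s ^ (n : ℤ)).x (s ^ (n : ℤ)).y) ?_
      fun n => hmem _ _ (hprop n)) hstab
  have htrace (a b : ℤ) : (h a b * h a b).trace =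
      3 + 8 * δ * b ^ 2 * (1 + a ^ 2 + δ * b ^ 2) := by
    have e4 : T * T * (T * T) = δ • (T * T) := by
      rw [← Matrix.mul_assoc, hT3, Matrix.smul_mul]
    have e5 : T * (T * T) = T * T * T := (Matrix.mul_assoc _ _ _).symm
    simp only [hh, Matrix.add_mul, Matrix.mul_add, Matrix.mul_one,
      Matrix.one_mul, Matrix.smul_mul, Matrix.mul_smul, e4, e5, hT3, smul_smul,
      smul_add, trace_add, trace_smul, htr, htr2, trace_one, Fintype.card_fin, smul_eq_mul]
    push_cast
    ring
  have hy0 (n : ℕ) : 0 ≤ (s ^ (n : ℤ)).y := by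
    have := hs.y_strictMono.monotone (Int.natCast_nonneg n)
    simpa using this
  intro n m hnm
  have h1 := congrArg trace hnm
  simp only [htrace] at h1
  have hxn := hprop n
  have hxm := hprop m
  have hyn := hy0 n
  have hym := hy0 m
  have key : (s ^ (n : ℤ)).y = (s ^ (m : ℤ)).y := by
    set a := (s ^ (n : ℤ)).x
    set b := (s ^ (n : ℤ)).y
    set a' := (s ^ (m : ℤ)).x
    set b' := (s ^ (m : ℤ)).y
    have h2 : δ * ((b ^ 2 - b' ^ 2) * (1 + δ * (b ^ 2 + b' ^ 2))) = 0 := by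
      have ea : a ^ 2 = 1 + δ * b ^ 2 := by linarith
      have ea' : a' ^ 2 = 1 + δ * b' ^ 2 := by linarith
      rw [ea, ea'] at h1
      linarith
    have h3 : 0 < 1 + δ * (b ^ 2 + b' ^ 2) := by positivity
    have h4 : b ^ 2 - b' ^ 2 = 0 := by
      rcases mul_eq_zero.mp h2 with h | h
      · omega
      · exact (mul_eq_zero.mp h).resolve_right h3.ne'
    exact (pow_left_inj₀ hyn hym two_ne_zero).mp (by linarith)
  exact_mod_cast hs.y_strictMono.injective key

/-- A non-isotropic vector has a non-isotropic orthogonal vector. -/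
lemma exists_orthogonal (A : Matrix (Fin 3) (Fin 3) ℤ) (hA : Aᵀ = A) (hdet : A.det ≠ 0)
    (v : Fin 3 → ℤ) (hv : v ⬝ᵥ A *ᵥ v ≠ 0) :
    ∃ z : Fin 3 → ℤ, z ⬝ᵥ A *ᵥ v = 0 ∧ z ⬝ᵥ A *ᵥ z ≠ 0 := by
  by_contra! hcon
  set D := v ⬝ᵥ A *ᵥ v with hD
  set w := A *ᵥ v with hw
  have hsymm (x y : Fin 3 → ℤ) : x ⬝ᵥ A *ᵥ y = y ⬝ᵥ A *ᵥ x := by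
    rw [dotProduct_mulVec, ← mulVec_transpose, hA, dotProduct_comm]
  have hx (x : Fin 3 → ℤ) : D * (x ⬝ᵥ A *ᵥ x) = (x ⬝ᵥ w) ^ 2 := by
    have h1 := hcon (D • x - (x ⬝ᵥ w) • v) (by
      simp only [sub_dotProduct, smul_dotProduct, smul_eq_mul]
      rw [← hD]; ring)
    simp only [mulVec_sub, mulVec_smul, sub_dotProduct, dotProduct_sub, smul_dotProduct,
      dotProduct_smul, smul_eq_mul] at h1
    rw [← hw, hsymm v x, ← hw, ← hD] at h1
    refine mul_left_cancel₀ hv ?_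
    linear_combination h1
  have hent (i j : Fin 3) : D * A i j = w i * w j := by
    have h1 := hx (Pi.single i 1)
    have h2 := hx (Pi.single j 1)
    have h3 := hx (Pi.single i 1 + Pi.single j 1)
    have h4 : A j i = A i j := congrFun (congrFun hA i) j
    simp only [mulVec_add, add_dotProduct, dotProduct_add, mulVec_single_one,
      single_one_dotProduct, col_apply] at h1 h2 h3
    rw [h4] at h3
    linarith
  have h5 : D ^ 3 * A.det = 0 := by
    have h6 : D ^ 3 * A.det = (D • A).det := by rw [det_smul, Fintype.card_fin]
    rw [h6, det_fin_three]
    simp only [Matrix.smul_apply, smul_eq_mul, hent]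
    ring
  exact (mul_ne_zero (pow_ne_zero 3 hv) hdet) h5

lemma det_mul_tripleProduct_sq (A : Matrix (Fin 3) (Fin 3) ℤ) (hA : Aᵀ = A) (y z v : Fin 3 → ℤ)
    (hzv : z ⬝ᵥ A *ᵥ v = 0) :
    A.det * (y ⬝ᵥ crossProduct z v) ^ 2 = (y ⬝ᵥ A *ᵥ y) * (z ⬝ᵥ A *ᵥ z) * (v ⬝ᵥ A *ᵥ v) -
      (z ⬝ᵥ A *ᵥ z) * (y ⬝ᵥ A *ᵥ v) ^ 2 - (v ⬝ᵥ A *ᵥ v) * (y ⬝ᵥ A *ᵥ z) ^ 2 := by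
  have hsymm (x y : Fin 3 → ℤ) : x ⬝ᵥ A *ᵥ y = y ⬝ᵥ A *ᵥ x := by
    rw [dotProduct_mulVec, ← mulVec_transpose, hA, dotProduct_comm]
  set E : Matrix (Fin 3) (Fin 3) ℤ := ![y, z, v] with hE
  have h (i j : Fin 3) : (E * A * Eᵀ) i j = E i ⬝ᵥ A *ᵥ E j := by
    rw [dotProduct_mulVec]
    rfl
  have h1 : (E * A * Eᵀ).det = E.det ^ 2 * A.det := by
    rw [det_mul, det_mul, det_transpose]; ring
  rw [triple_product_eq_det, ← hE, mul_comm, ← h1, det_fin_three]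
  simp only [h]
  have e0 : E 0 = y := rfl
  have e1 : E 1 = z := rfl
  have e2 : E 2 = v := rfl
  rw [e0, e1, e2, hsymm v z, hsymm v y, hsymm z y, hzv]
  ring

/-- A non-degenerate integral ternary form representing `D / 2` such that `-det * D` is a square
is, up to scaling, the pullback of the discriminant of binary forms. -/
lemma exists_matrix_disc (A : Matrix (Fin 3) (Fin 3) ℤ) (hA : Aᵀ = A) (hdet : A.det ≠ 0)
    (v : Fin 3 → ℤ) (hv : v ⬝ᵥ A *ᵥ v ≠ 0) (hsq : IsSquare (-A.det * (v ⬝ᵥ A *ᵥ v))) :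
    ∃ (P : Matrix (Fin 3) (Fin 3) ℤ) (m N : ℤ), P.det ≠ 0 ∧ 0 < N ∧
      m * (v ⬝ᵥ A *ᵥ v) = N ^ 2 ∧
      ∀ y : Fin 3 → ℤ, (y ᵥ* P) 1 ^ 2 - 4 * (y ᵥ* P) 0 * (y ᵥ* P) 2 = m * (y ⬝ᵥ A *ᵥ y) := by
  obtain ⟨z, hzv, hz⟩ := exists_orthogonal A hA hdet v hv
  obtain ⟨e, he⟩ := hsq
  have hgram (y : Fin 3 → ℤ) := det_mul_tripleProduct_sq A hA y z v hzv
  have hcross : crossProduct z v ⬝ᵥ crossProduct (A *ᵥ z) (A *ᵥ v) =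
      (z ⬝ᵥ A *ᵥ z) * (v ⬝ᵥ A *ᵥ v) := by
    rw [cross_dot_cross, hzv]; ring
  set D := v ⬝ᵥ A *ᵥ v with hD
  set p := A *ᵥ z
  set q := A *ᵥ v
  set r := crossProduct z v
  set ζ := z ⬝ᵥ p
  set d := A.det
  have he0 : e ≠ 0 := by
    rintro rfl
    exact mul_ne_zero (neg_ne_zero.mpr hdet) hv (by simpa using he)
  refine ⟨Matrix.of fun i => ![-(ζ * D) * (e * p i - d * r i), 2 * ζ * e * q i,
    e * p i + d * r i], 4 * ζ ^ 2 * e ^ 2 * D, |2 * ζ * e * D|, ?_, ?_, ?_, fun y => ?_⟩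
  · have : det (Matrix.of fun i => ![-(ζ * D) * (e * p i - d * r i), 2 * ζ * e * q i,
        e * p i + d * r i]) = (-(ζ * D)) * (2 * ζ * e) * (2 * e * d) * (r ⬝ᵥ crossProduct p q) := by
      rw [det_fin_three]
      simp [cross_apply, dotProduct, Fin.sum_univ_three]
      ring
    rw [this, hcross]
    simp [hz, hv, he0, hdet, ζ]
  · simp [hz, hv, he0, ζ]
  · rw [sq_abs]; ring
  · have e0 : (y ᵥ* Matrix.of fun i => ![-(ζ * D) * (e * p i - d * r i), 2 * ζ * e * q i,
        e * p i + d * r i]) = ![-(ζ * D) * (e * (y ⬝ᵥ p) - d * (y ⬝ᵥ r)), 2 * ζ * e * (y ⬝ᵥ q),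
        e * (y ⬝ᵥ p) + d * (y ⬝ᵥ r)] := by
      ext i
      fin_cases i <;> simp [vecMul, dotProduct, Fin.sum_univ_three] <;> ring
    rw [e0]
    have h := hgram y
    simp only [cons_val_zero, cons_val_one, cons_val]
    linear_combination (-4 * ζ * D * d) * h + (4 * ζ * ((y ⬝ᵥ A *ᵥ y) * ζ * D -
      ζ * (y ⬝ᵥ q) ^ 2 - D * (y ⬝ᵥ p) ^ 2)) * he

/-- counting integral points on an integral one-sheeted hyperboloid when the
stabilizer of `v₀` is isotropic over `ℚ` (i.e. has finitely many integral points). -/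
theorem integral_hyperboloid_count
    (c : Fin 3 → Fin 3 → ℤ)
    (hsig : ∃ e : (Fin 3 → ℝ) ≃ₗ[ℝ] (Fin 3 → ℝ),
      ∀ v, QR c (e v) = (v 0)^2 + (v 1)^2 - (v 2)^2)
    (v₀ : Fin 3 → ℤ) (hv₀ : 0 < QZ c v₀)
    (hstab : Set.Finite {g : Matrix (Fin 3) (Fin 3) ℤ |
      g.det = 1 ∧
      (∀ x : Fin 3 → ℝ, QR c (Matrix.vecMul x (g.map (Int.cast : ℤ → ℝ))) = QR c x) ∧
      Matrix.vecMul v₀ g = v₀})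
    (nrm : Seminorm ℝ (Fin 3 → ℝ)) (hnrm : ∀ v, nrm v = 0 → v = 0) :
    ∃ C > (0:ℝ),
      Tendsto (fun T : ℝ =>
          (Set.ncard {x : Fin 3 → ℤ |
              QZ c x = QZ c v₀ ∧ nrm (fun i => (x i : ℝ)) < T} : ℝ) / (T * Real.log T))
        atTop (𝓝 C) := by
  have hdet := det_gramInt_neg c hsig
  have hsq := isSquare_of_finite_stabilizer c hdet v₀ hv₀ hstab
  rw [← dotProduct_gramInt_self] at hsq
  obtain ⟨P, m, N, hP, hN, hmN, hdisc⟩ := exists_matrix_disc (gramInt c) (transpose_gramInt c)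
    hdet.ne v₀ (by rw [dotProduct_gramInt_self]; positivity) hsq
  simp only [dotProduct_gramInt_self] at hmN hdisc
  have hm : m ≠ 0 := by
    rintro rfl
    rw [zero_mul] at hmN
    exact (pow_pos hN 2).ne hmN
  set PR := P.map (Int.cast : ℤ → ℝ) with hPR
  have hdetR : PR.det = (P.det : ℝ) := ((Int.castRingHom ℝ).map_det P).symm
  have hunit : IsUnit PR.det := by
    rw [hdetR, isUnit_iff_ne_zero]
    exact_mod_cast hP
  have hcast (x : Fin 3 → ℤ) :
      (fun i => ((x ᵥ* P) i : ℝ)) = (fun i => (x i : ℝ)) ᵥ* PR := by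
    ext i
    simp [vecMul, dotProduct, hPR]
  have hinj : Function.Injective fun x : Fin 3 → ℤ => x ᵥ* P := by
    intro x y hxy
    have h := congrArg (· ᵥ* P.adjugate) hxy
    simp only [vecMul_vecMul, mul_adjugate, vecMul_smul, vecMul_one] at h
    ext i
    exact mul_left_cancel₀ hP (congrFun h i)
  set G : Seminorm ℝ (Fin 3 → ℝ) := nrm.comp (Matrix.vecMulLinear PR⁻¹) with hG
  have hGP (v : Fin 3 → ℝ) : G (v ᵥ* PR) = nrm v := by
    rw [hG, Seminorm.comp_apply, vecMulLinear_apply, vecMul_vecMul, mul_nonsing_inv _ hunit,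
      vecMul_one]
  have hGdef (v : Fin 3 → ℝ) (hv : G v = 0) : v = 0 := by
    have h1 : v = (v ᵥ* PR⁻¹) ᵥ* PR := by
      rw [vecMul_vecMul, nonsing_inv_mul _ hunit, vecMul_one]
    rw [h1] at hv ⊢
    rw [hGP] at hv
    rw [hnrm _ hv, zero_vecMul]
  have hper : ∀ y y' : Fin 3 → ℤ, (∀ i, y i ≡ y' i [ZMOD P.det.natAbs]) →
      y ∈ Set.range (fun x => x ᵥ* P) → y' ∈ Set.range (fun x => x ᵥ* P) := by
    rintro y y' h ⟨x, rfl⟩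
    choose k hk using fun i => Int.natAbs_dvd.mp (h i).dvd
    refine ⟨x + k ᵥ* P.adjugate, ?_⟩
    ext i
    simp only [add_vecMul, vecMul_vecMul, adjugate_mul, vecMul_smul, vecMul_one, Pi.add_apply,
      Pi.smul_apply, smul_eq_mul]
    linarith [hk i]
  have hneg : ∀ y ∈ Set.range (fun x => x ᵥ* P), -y ∈ Set.range (fun x => x ᵥ* P) := by
    rintro _ ⟨x, rfl⟩
    exact ⟨-x, neg_vecMul _ _⟩
  obtain ⟨C, hC, hlim⟩ := exists_tendsto_disc_count G hGdef (Set.range fun x => x ᵥ* P) N hN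
    P.det.natAbs (Int.natAbs_pos.mpr hP) hper hneg ⟨v₀ ᵥ* P, ⟨v₀, rfl⟩, by rw [hdisc, hmN]⟩
  refine ⟨C, hC, hlim.congr fun T => ?_⟩
  congr 2
  rw [← Set.ncard_image_of_injective {x : Fin 3 → ℤ |
    QZ c x = QZ c v₀ ∧ nrm (fun i => (x i : ℝ)) < T} hinj]
  congr 1
  ext y
  constructor
  · rintro ⟨⟨x, rfl⟩, hy, hlt⟩
    simp only [hdisc, hcast, hGP] at hy hlt
    refine ⟨x, ⟨?_, hlt⟩, rfl⟩
    rw [← hmN] at hy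
    have := mul_left_cancel₀ hm hy
    linarith
  · rintro ⟨x, ⟨hx, hlt⟩, rfl⟩
    refine ⟨⟨x, rfl⟩, ?_, ?_⟩
    · simp only [hdisc, hx, hmN]
    · simpa only [hcast, hGP] using hlt
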